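/- arXiv:math/0411067 — 2 statements merged into one kernel-verified Lean document; each statement's English description precedes it below -/
import Mathlib

section
/- Let X be a compact Hausdorff space and let A be a natural uniform algebra on X with dense invertibles. Let S be a Shilov boundary for A, i.e., S is a closed subset of X with sup_{x ∈ S} |f(x)| = sup_{x ∈ X} |f(x)| for all f ∈ A, and S is contained in every closed subset T of X satisfying sup_{x ∈ T} |f(x)| = sup_{x ∈ X} |f(x)| for all f ∈ A. Then for every f ∈ A whose zero set Z(f) = {x ∈ X : f(x) = 0} is nonempty, every connected component of Z(f) has nonempty intersection with S. -/
theorem exists_pow_norm_lt_of_characters {Q : Type*} [NormedCommRing Q] [NormedAlgebra ℂ Q]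
    [CompleteSpace Q] (a : Q) (h : ∀ χ : Q →ₐ[ℂ] ℂ, ‖χ a‖ < 1) {ε : ℝ} (hε : 0 < ε) :
    ∃ n : ℕ, 1 ≤ n ∧ ‖a ^ n‖ < ε := by
  rcases subsingleton_or_nontrivial Q with hQ | hQ
  · exact ⟨1, le_rfl, by rwa [Subsingleton.elim (a ^ 1) 0, norm_zero]⟩
  have hr : spectralRadius ℂ a < (1 : NNReal) := by
    apply spectrum.spectralRadius_lt_of_forall_lt
    intro z hz
    obtain ⟨φ, rfl⟩ := WeakDual.CharacterSpace.mem_spectrum_iff_exists.mp hz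
    exact_mod_cast h (WeakDual.CharacterSpace.equivAlgHom φ)
  have hsmall : ∀ᶠ n : ℕ in Filter.atTop, ‖a ^ n‖ < ε := by
    obtain ⟨r, h1, h2⟩ := ENNReal.lt_iff_exists_nnreal_btwn.mp hr
    have h3 := (spectrum.pow_nnnorm_pow_one_div_tendsto_nhds_spectralRadius a).eventually_lt_const h1
    have h4 : Filter.Tendsto (fun n : ℕ => (r : ℝ) ^ n) Filter.atTop (nhds 0) :=
      tendsto_pow_atTop_nhds_zero_of_lt_one r.2 (by exact_mod_cast h2)
    filter_upwards [h3, h4.eventually_lt_const hε, Filter.eventually_ge_atTop 1] with n h5 h6 h7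
    refine lt_of_le_of_lt ?_ h6
    have h8 : (‖a ^ n‖₊ : ENNReal) ≤ (r : ENNReal) ^ n := by
      have := ENNReal.rpow_le_rpow h5.le (Nat.cast_nonneg (α := ℝ) n)
      rwa [← ENNReal.rpow_mul, one_div, inv_mul_cancel₀ (by positivity), ENNReal.rpow_one,
        ENNReal.rpow_natCast] at this
    exact_mod_cast h8
  obtain ⟨n, h1, h2⟩ := (hsmall.and (Filter.eventually_ge_atTop 1)).exists
  exact ⟨n, h2, h1⟩

theorem exists_pow_sub_mul_norm_lt {R : Type*} [NormedCommRing R] [NormedAlgebra ℂ R]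
    [CompleteSpace R] (b u : R) (h : ∀ χ : R →ₐ[ℂ] ℂ, χ u = 0 → ‖χ b‖ < 1) {ε : ℝ} (hε : 0 < ε) :
    ∃ n : ℕ, 1 ≤ n ∧ ∃ c, ‖b ^ n - u * c‖ < ε := by
  let J : Ideal R := (Ideal.span {u}).closure
  have hJ : IsClosed (J : Set R) := by
    rw [Ideal.coe_closure]; exact isClosed_closure
  have : IsClosed (J : Set R) := hJ
  have huJ : u ∈ J := by
    have : u ∈ (J : Set R) := by
      rw [Ideal.coe_closure]; exact subset_closure (Ideal.mem_span_singleton_self u)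
    exact this
  obtain ⟨n, hn, hlt⟩ := exists_pow_norm_lt_of_characters (Ideal.Quotient.mkₐ ℂ J b)
    (fun χ => h (χ.comp (Ideal.Quotient.mkₐ ℂ J)) (by
      have : Ideal.Quotient.mkₐ ℂ J u = 0 := Ideal.Quotient.eq_zero_iff_mem.mpr huJ
      simp only [AlgHom.comp_apply, this, map_zero])) (half_pos hε)
  refine ⟨n, hn, ?_⟩
  obtain ⟨m, hm, hmlt⟩ := Ideal.Quotient.norm_mk_lt (I := J) (Ideal.Quotient.mkₐ ℂ J b ^ n)
    (half_pos hε)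
  have hmem : b ^ n - m ∈ (J : Set R) := by
    refine Ideal.Quotient.eq.mp ?_
    rw [hm]; simp
  rw [Ideal.coe_closure] at hmem
  obtain ⟨v, hv, hvd⟩ := Metric.mem_closure_iff.mp hmem (ε - ‖m‖) (by linarith)
  obtain ⟨c, rfl⟩ := Ideal.mem_span_singleton'.mp hv
  refine ⟨c, ?_⟩
  rw [dist_eq_norm] at hvd
  calc ‖b ^ n - u * c‖ = ‖(b ^ n - m - c * u) + m‖ := by congr 1; ring
    _ ≤ _ := norm_add_le _ _
    _ < ε := by linarith

/-- Every point at which evaluation is bounded by the supremum over `K` belongs to `K`. -/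
def HullClosed {X : Type*} [TopologicalSpace X] (A : Subalgebra ℂ C(X, ℂ)) (K : Set X) : Prop :=
  ∀ x, (∀ g ∈ A, ∃ y ∈ K, ‖g x‖ ≤ ‖g y‖) → x ∈ K

theorem HullClosed.inter_disc {X : Type*} [TopologicalSpace X] {A : Subalgebra ℂ C(X, ℂ)}
    {K : Set X} (hKA : HullClosed A K) {h : C(X, ℂ)} (hh : h ∈ A) :
    HullClosed A (K ∩ {x | ‖h x‖ ≤ 1}) := by
  intro x hx
  refine ⟨hKA x fun g hg => ?_, ?_⟩
  · obtain ⟨y, hy, hle⟩ := hx g hg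
    exact ⟨y, hy.1, hle⟩
  · obtain ⟨y, hy, hle⟩ := hx h hh
    exact hle.trans hy.2

theorem norm_character_le_of_isClosed {K : Type*} [TopologicalSpace K] [CompactSpace K] [Nonempty K]
    {B : Subalgebra ℂ C(K, ℂ)} (hB : IsClosed (B : Set C(K, ℂ))) (χ : B →ₐ[ℂ] ℂ) (b : B) {M : ℝ}
    (hM : ∀ y, ‖(b : C(K, ℂ)) y‖ ≤ M) : ‖χ b‖ ≤ M := by
  have hBc : CompleteSpace B := hB.completeSpace_coe
  have h1 : ‖χ b‖ ≤ ‖b‖ * ‖(1 : B)‖ := AlgHom.norm_apply_le_self_mul_norm_one χ b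
  have h2 : ‖(1 : B)‖ = 1 := norm_one (α := C(K, ℂ))
  rw [h2, mul_one] at h1
  exact h1.trans ((ContinuousMap.norm_le_of_nonempty (b : C(K, ℂ))).mpr hM)

theorem exists_pow_sub_mul_lt_of_isClosed {K : Type*} [TopologicalSpace K] [CompactSpace K]
    {B : Subalgebra ℂ C(K, ℂ)} (hB : IsClosed (B : Set C(K, ℂ))) (b u : B)
    (h : ∀ χ : B →ₐ[ℂ] ℂ, χ u = 0 → ‖χ b‖ < 1) {ε : ℝ} (hε : 0 < ε) :
    ∃ n : ℕ, 1 ≤ n ∧ ∃ c ∈ B, ∀ y, ‖(b : C(K, ℂ)) y ^ n - (u : C(K, ℂ)) y * c y‖ < ε := by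
  have hBc : CompleteSpace B := hB.completeSpace_coe
  obtain ⟨n, hn, c, hc⟩ := exists_pow_sub_mul_norm_lt b u h hε
  exact ⟨n, hn, c, c.2, fun y => lt_of_le_of_lt
    (ContinuousMap.norm_coe_le_norm ((b ^ n - u * c : B) : C(K, ℂ)) y) hc⟩

theorem exists_pow_sub_mul_lt {X : Type*} [TopologicalSpace X] [CompactSpace X]
    {A : Subalgebra ℂ C(X, ℂ)}
    (hnat : ∀ φ : A →ₐ[ℂ] ℂ, ∃ x : X, ∀ f : A, φ f = (f : C(X, ℂ)) x)
    {K : Set X} (hK : IsClosed K) (hKA : HullClosed A K) {f h : C(X, ℂ)} (hf : f ∈ A) (hh : h ∈ A)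
    (z : ℂ) (hlt : ∀ x ∈ K, h x = z → ‖f x‖ < 1) :
    ∃ n : ℕ, 1 ≤ n ∧ ∃ a ∈ A, ∀ x ∈ K, ‖f x ^ n - (z - h x) * a x‖ < 1 / 4 := by
  rcases K.eq_empty_or_nonempty with rfl | hne
  · exact ⟨1, le_rfl, 0, A.zero_mem, by simp⟩
  have : CompactSpace K := isCompact_iff_compactSpace.mp hK.isCompact
  have : Nonempty K := hne.to_subtype
  let ρ : C(X, ℂ) →ₐ[ℂ] C(K, ℂ) :=
    ContinuousMap.compRightAlgHom ℂ ℂ (⟨Subtype.val, continuous_subtype_val⟩ : C(K, X))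
  have hρ (g : C(X, ℂ)) (y : K) : ρ g y = g y := rfl
  let B : Subalgebra ℂ C(K, ℂ) := (A.map ρ).topologicalClosure
  have hmem (g : A) : ρ g ∈ B :=
    (A.map ρ).le_topologicalClosure ⟨g, g.2, rfl⟩
  let σ : A →ₐ[ℂ] B := (ρ.comp A.val).codRestrict B hmem
  have hσ (g : A) : ((σ g : B) : C(K, ℂ)) = ρ g := rfl
  have hB : IsClosed (B : Set C(K, ℂ)) := (A.map ρ).isClosed_topologicalClosure
  obtain ⟨n, hn, c, hcB, hc⟩ := exists_pow_sub_mul_lt_of_isClosed hB (σ ⟨f, hf⟩)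
    (σ (algebraMap ℂ A z - ⟨h, hh⟩)) (fun χ hχ => by
      obtain ⟨x, hx⟩ := hnat (χ.comp σ)
      have hxK : x ∈ K := by
        apply hKA
        intro g hg
        obtain ⟨y, hy, hmax⟩ := hK.isCompact.exists_isMaxOn hne
          (f := fun y => ‖g y‖) (by fun_prop)
        refine ⟨y, hy, ?_⟩
        have h1 : g x = χ (σ ⟨g, hg⟩) := (hx ⟨g, hg⟩).symm
        rw [h1]
        exact norm_character_le_of_isClosed hB χ _ fun w => hmax w.2
      have hz : h x = z := by
        have := hx (algebraMap ℂ A z - ⟨h, hh⟩)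
        rw [AlgHom.comp_apply, hχ] at this
        have h2 : (0 : ℂ) = z - h x := this
        linear_combination h2
      have := hx ⟨f, hf⟩
      rw [AlgHom.comp_apply] at this
      rw [this]
      exact hlt x hxK hz) (show (0 : ℝ) < 1 / 8 by norm_num)
  refine ⟨n, hn, ?_⟩
  let u : C(X, ℂ) := algebraMap ℂ C(X, ℂ) z - h
  have hcl : c ∈ closure ((A.map ρ : Subalgebra ℂ C(K, ℂ)) : Set C(K, ℂ)) := by
    rw [← Subalgebra.topologicalClosure_coe]; exact hcB
  obtain ⟨_, ⟨a, ha, rfl⟩, hd⟩ := Metric.mem_closure_iff.mp hcl (1 / (8 * (‖ρ u‖ + 1)))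
    (by positivity)
  refine ⟨a, ha, fun x hx => ?_⟩
  have h1 : ‖f x ^ n - (z - h x) * c ⟨x, hx⟩‖ < 1 / 8 :=
    hc ⟨x, hx⟩
  have h2 : ‖z - h x‖ ≤ ‖ρ u‖ := ContinuousMap.norm_coe_le_norm (ρ u) ⟨x, hx⟩
  have h3 : ‖c ⟨x, hx⟩ - a x‖ < 1 / (8 * (‖ρ u‖ + 1)) := by
    rw [dist_eq_norm] at hd
    exact lt_of_le_of_lt (ContinuousMap.norm_coe_le_norm (c - ρ a) ⟨x, hx⟩) hd
  have h4 : ‖(z - h x) * (c ⟨x, hx⟩ - a x)‖ ≤ 1 / 8 := by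
    rw [norm_mul]
    have h5 := norm_nonneg (ρ u)
    calc _ ≤ ‖ρ u‖ * (1 / (8 * (‖ρ u‖ + 1))) := by gcongr
      _ ≤ 1 / 8 := by
        rw [mul_one_div, div_le_div_iff₀ (by positivity) (by positivity)]; linarith
  calc _ = ‖(f x ^ n - (z - h x) * c ⟨x, hx⟩)
        + (z - h x) * (c ⟨x, hx⟩ - a x)‖ := by congr 1; ring
    _ ≤ _ := norm_add_le _ _
    _ < 1 / 4 := by linarith

section Pointwise

variable {X : Type*} [TopologicalSpace X] {A : Subalgebra ℂ C(X, ℂ)}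

theorem exists_pow_mul_sub_mul_le {K : Set X} {f h a : C(X, ℂ)} (hf : f ∈ A) (hh : h ∈ A)
    (ha : a ∈ A) {z : ℂ} {N : ℕ} {M : ℝ} (hM : 1 ≤ M) (hfM : ∀ x ∈ K, ‖f x‖ ^ N ≤ M)
    (hle : ∀ x ∈ K, ‖f x ^ N - (z - h x) * a x‖ ≤ 1 / 2) (m : ℕ) :
    ∃ a' ∈ A, ∀ x ∈ K, ‖f x ^ (N * m) - (z - h x) * a' x‖ ≤ (1 / 2) ^ m ∧
      ‖a' x‖ ≤ ‖a x‖ * (m * M ^ m) := by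
  let b : C(X, ℂ) := f ^ N - (algebraMap ℂ C(X, ℂ) z - h) * a
  have hb : b ∈ A := A.sub_mem (A.pow_mem hf N)
    (A.mul_mem (A.sub_mem (A.algebraMap_mem z) hh) ha)
  have hbx (x : X) : b x = f x ^ N - (z - h x) * a x := rfl
  refine ⟨a * ∑ i ∈ Finset.range m, (f ^ N) ^ i * b ^ (m - 1 - i), A.mul_mem ha
    (A.sum_mem fun i _ => A.mul_mem (A.pow_mem (A.pow_mem hf N) i) (A.pow_mem hb _)),
    fun x hx => ?_⟩
  have hbn : ‖b x‖ ≤ 1 / 2 := hle x hx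
  have hev : (a * ∑ i ∈ Finset.range m, (f ^ N) ^ i * b ^ (m - 1 - i)) x
      = a x * ∑ i ∈ Finset.range m, (f x ^ N) ^ i * b x ^ (m - 1 - i) := by
    simp [ContinuousMap.sum_apply]
  rw [hev]
  constructor
  · have h1 := geom_sum₂_mul (f x ^ N) (b x) m
    have h2 : f x ^ (N * m) - (z - h x) *
        (a x * ∑ i ∈ Finset.range m, (f x ^ N) ^ i * b x ^ (m - 1 - i)) = b x ^ m := by
      have h3 : f x ^ N - b x = (z - h x) * a x := by rw [hbx]; ring
      rw [h3] at h1
      rw [pow_mul]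
      linear_combination -h1
    rw [h2, norm_pow]
    gcongr
  · rw [norm_mul]
    gcongr
    refine (norm_sum_le _ _).trans ?_
    have : ∀ i ∈ Finset.range m, ‖(f x ^ N) ^ i * b x ^ (m - 1 - i)‖ ≤ M ^ m := by
      intro i hi
      rw [norm_mul, norm_pow, norm_pow, norm_pow]
      have h4 : ‖b x‖ ^ (m - 1 - i) ≤ 1 := pow_le_one₀ (norm_nonneg _) (by linarith)
      calc _ ≤ M ^ i * 1 := by
            gcongr
            exact hfM x hx
        _ ≤ M ^ m := by
            rw [mul_one]
            exact pow_le_pow_right₀ hM (Finset.mem_range.mp hi).le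
    simpa using Finset.sum_le_card_nsmul _ _ _ this

theorem exists_uniform_pow_sub_mul_le [CompactSpace X] {K : Set X} {f h : C(X, ℂ)} (hf : f ∈ A)
    (hh : h ∈ A) {W : Set ℂ} (hW : IsCompact W)
    (hloc : ∀ z ∈ W, ∃ n : ℕ, 1 ≤ n ∧ ∃ a ∈ A, ∀ x ∈ K, ‖f x ^ n - (z - h x) * a x‖ < 1 / 4) :
    ∃ N : ℕ, 1 ≤ N ∧ ∃ C : ℝ, ∀ z ∈ W, ∃ a ∈ A, ∀ x ∈ K,
      ‖f x ^ N - (z - h x) * a x‖ ≤ 1 / 2 ∧ ‖a x‖ ≤ C := by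
  refine hW.induction_on (p := fun s => ∃ N : ℕ, 1 ≤ N ∧ ∃ C : ℝ, ∀ z ∈ s, ∃ a ∈ A, ∀ x ∈ K,
      ‖f x ^ N - (z - h x) * a x‖ ≤ 1 / 2 ∧ ‖a x‖ ≤ C) ⟨1, le_rfl, 0, by simp⟩ ?_ ?_ ?_
  · rintro s t hst ⟨N, hN, C, H⟩
    exact ⟨N, hN, C, fun z hz => H z (hst hz)⟩
  · have key : ∀ (N m : ℕ) (C : ℝ), 1 ≤ m → ∃ C' : ℝ, ∀ z, (∃ a ∈ A, ∀ x ∈ K,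
        ‖f x ^ N - (z - h x) * a x‖ ≤ 1 / 2 ∧ ‖a x‖ ≤ C) → ∃ a ∈ A, ∀ x ∈ K,
        ‖f x ^ (N * m) - (z - h x) * a x‖ ≤ 1 / 2 ∧ ‖a x‖ ≤ C' := by
      intro N m C hm
      refine ⟨C * (m * (max 1 (‖f‖ ^ N)) ^ m), ?_⟩
      rintro z ⟨a, ha, H⟩
      obtain ⟨a', ha', H'⟩ := exists_pow_mul_sub_mul_le hf hh ha (le_max_left 1 (‖f‖ ^ N))
        (fun x hx => le_max_of_le_right
          (pow_le_pow_left₀ (norm_nonneg _) (f.norm_coe_le_norm x) N)) (fun x hx => (H x hx).1) m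
      refine ⟨a', ha', fun x hx => ⟨(H' x hx).1.trans ?_, (H' x hx).2.trans ?_⟩⟩
      · exact pow_le_of_le_one (by norm_num) (by norm_num) (by omega)
      · gcongr
        exact (H x hx).2
    rintro s t ⟨N₁, hN₁, C₁, H₁⟩ ⟨N₂, hN₂, C₂, H₂⟩
    obtain ⟨D₁, E₁⟩ := key N₁ N₂ C₁ hN₂
    obtain ⟨D₂, E₂⟩ := key N₂ N₁ C₂ hN₁
    refine ⟨N₁ * N₂, Nat.mul_pos hN₁ hN₂, max D₁ D₂, ?_⟩
    rintro z (hz | hz)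
    · obtain ⟨a, ha, H⟩ := E₁ z (H₁ z hz)
      exact ⟨a, ha, fun x hx => ⟨(H x hx).1, le_max_of_le_left (H x hx).2⟩⟩
    · obtain ⟨a, ha, H⟩ := E₂ z (H₂ z hz)
      refine ⟨a, ha, fun x hx => ⟨?_, le_max_of_le_right (H x hx).2⟩⟩
      rw [mul_comm N₁]
      exact (H x hx).1
  · intro z hz
    obtain ⟨n, hn, a, ha, H⟩ := hloc z hz
    refine ⟨Metric.ball z (1 / (4 * (‖a‖ + 1))),
      mem_nhdsWithin_of_mem_nhds (Metric.ball_mem_nhds z (by positivity)), n, hn, ‖a‖,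
      fun w hw => ⟨a, ha, fun x hx => ⟨?_, a.norm_coe_le_norm x⟩⟩⟩
    rw [mem_ball_iff_norm] at hw
    have h1 : ‖(w - z) * a x‖ ≤ 1 / 4 := by
      rw [norm_mul]
      calc _ ≤ 1 / (4 * (‖a‖ + 1)) * ‖a‖ := by
            gcongr
            exact a.norm_coe_le_norm x
        _ ≤ 1 / 4 := by
            rw [div_mul_eq_mul_div, one_mul, div_le_div_iff₀ (by positivity) (by positivity)]
            linarith
    calc _ = ‖(f x ^ n - (z - h x) * a x) - (w - z) * a x‖ := by congr 1; ring
      _ ≤ _ := norm_sub_le _ _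
      _ ≤ 1 / 2 := by linarith [H x hx]

end Pointwise

theorem IsPrimitiveRoot.sum_pow_div_pow_sub {q : ℕ} {ζ : ℂ} (hζ : IsPrimitiveRoot ζ q)
    (hq : 1 ≤ q) {w : ℂ} (hw : w ^ q ≠ 1) :
    ∑ j ∈ Finset.range q, ζ ^ j / (ζ ^ j - w) = q / (1 - w ^ q) := by
  have hζ0 : ζ ≠ 0 := hζ.ne_zero (by omega)
  have hden : 1 - w ^ q ≠ 0 := sub_ne_zero.mpr (Ne.symm hw)
  have hterm (j : ℕ) : ζ ^ j / (ζ ^ j - w)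
      = (∑ i ∈ Finset.range q, w ^ i * (ζ⁻¹ ^ i) ^ j) / (1 - w ^ q) := by
    have h1 : ζ ^ j ≠ 0 := pow_ne_zero _ hζ0
    have h2 : (ζ⁻¹ ^ j) ^ q = 1 := by
      rw [← pow_mul, mul_comm, pow_mul, inv_pow, hζ.pow_eq_one, inv_one, one_pow]
    have h3 : ζ ^ j - w ≠ 0 := by
      intro h
      apply hw
      rw [← sub_eq_zero.mp h, ← pow_mul, mul_comm, pow_mul, hζ.pow_eq_one, one_pow]
    have h4 := geom_sum_mul (w * ζ⁻¹ ^ j) q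
    rw [mul_pow, h2, mul_one] at h4
    have h5 : ∑ i ∈ Finset.range q, w ^ i * (ζ⁻¹ ^ i) ^ j
        = ∑ i ∈ Finset.range q, (w * ζ⁻¹ ^ j) ^ i :=
      Finset.sum_congr rfl fun i _ => by rw [mul_pow, ← pow_mul, ← pow_mul, mul_comm i j]
    rw [h5, div_eq_div_iff h3 hden]
    have h6 : ζ⁻¹ ^ j * ζ ^ j = 1 := by rw [← mul_pow, inv_mul_cancel₀ hζ0, one_pow]
    linear_combination ζ ^ j * h4
      - (∑ i ∈ Finset.range q, (w * ζ⁻¹ ^ j) ^ i) * w * h6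
  simp_rw [hterm]
  rw [← Finset.sum_div, Finset.sum_comm]
  congr 1
  rw [Finset.sum_eq_single_of_mem 0 (Finset.mem_range.mpr (by omega))]
  · simp
  · intro i hi hi0
    rw [← Finset.mul_sum]
    have hne : ζ⁻¹ ^ i ≠ 1 := by
      rw [inv_pow, ne_eq, inv_eq_one]
      exact hζ.pow_ne_one_of_pos_of_lt hi0 (Finset.mem_range.mp hi)
    have := geom_sum_mul (ζ⁻¹ ^ i) q
    rw [← pow_mul, mul_comm i q, pow_mul, inv_pow ζ q, hζ.pow_eq_one, inv_one, one_pow,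
      sub_self] at this
    rw [(mul_eq_zero.mp this).resolve_right (sub_ne_zero.mpr hne), mul_zero]

section Cutoff

variable {X : Type*} [TopologicalSpace X] {A : Subalgebra ℂ C(X, ℂ)}

theorem exists_discrete_cauchy {K : Set X} {F h : C(X, ℂ)} {R C ε : ℝ} (hR : 0 < R)
    (H : ∀ z : ℂ, ‖z‖ = R → ∃ a ∈ A, ∀ x ∈ K, ‖F x - (z - h x) * a x‖ ≤ ε ∧ ‖a x‖ ≤ C)
    {q : ℕ} (hq : 1 ≤ q) :
    ∃ k ∈ A, ∀ x ∈ K, ‖k x‖ ≤ R * C ∧ (‖h x‖ ≠ R →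
      ‖k x - F x / (1 - (h x / R) ^ q)‖ ≤ R * ε / |‖h x‖ - R|) := by
  have hq0 : (q : ℂ) ≠ 0 := by exact_mod_cast (by omega : q ≠ 0)
  have hq0' : (0 : ℝ) < q := by exact_mod_cast hq
  have hR0 : (R : ℂ) ≠ 0 := by exact_mod_cast hR.ne'
  let ζ : ℂ := Complex.exp (2 * Real.pi * Complex.I / q)
  have hζ : IsPrimitiveRoot ζ q := Complex.isPrimitiveRoot_exp q (by omega)
  have hζn (j : ℕ) : ‖(R : ℂ) * ζ ^ j‖ = R := by
    rw [norm_mul, norm_pow, hζ.norm'_eq_one (by omega), one_pow, mul_one, Complex.norm_real,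
      Real.norm_of_nonneg hR.le]
  choose a ha haK using fun j : ℕ => H _ (hζn j)
  refine ⟨∑ j ∈ Finset.range q, ((R : ℂ) * ζ ^ j / q) • a j,
    A.sum_mem fun j _ => A.smul_mem (ha j) _, fun x hx => ?_⟩
  have hev : (∑ j ∈ Finset.range q, ((R : ℂ) * ζ ^ j / q) • a j) x
      = ∑ j ∈ Finset.range q, ((R : ℂ) * ζ ^ j / q) * a j x := by
    simp [ContinuousMap.sum_apply]
  rw [hev]
  have hcoef (j : ℕ) : ‖(R : ℂ) * ζ ^ j / q‖ = R / q := by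
    rw [norm_div, hζn, Complex.norm_natCast]
  constructor
  · have : ∀ j ∈ Finset.range q, ‖((R : ℂ) * ζ ^ j / q) * a j x‖ ≤ R / q * C := fun j _ => by
      rw [norm_mul, hcoef]
      gcongr
      exact (haK j x hx).2
    refine (norm_sum_le_of_le _ this).trans_eq ?_
    rw [Finset.sum_const, Finset.card_range, nsmul_eq_mul]
    field_simp
  · intro hne
    have hwq : (h x / R) ^ q ≠ 1 := by
      intro h1
      have h2 : ‖h x / R‖ = 1 := Complex.norm_eq_one_of_pow_eq_one h1 (by omega)
      rw [norm_div, Complex.norm_real, Real.norm_of_nonneg hR.le, div_eq_one_iff_eq hR.ne'] at h2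
      exact hne h2
    have hpos : 0 < |‖h x‖ - R| := abs_pos.mpr (sub_ne_zero.mpr hne)
    have hdist (j : ℕ) : |‖h x‖ - R| ≤ ‖(R : ℂ) * ζ ^ j - h x‖ := by
      have := abs_norm_sub_norm_le (h x) ((R : ℂ) * ζ ^ j)
      rwa [hζn, norm_sub_rev] at this
    have hdne (j : ℕ) : (R : ℂ) * ζ ^ j - h x ≠ 0 := norm_pos_iff.mp (hpos.trans_le (hdist j))
    have hsum : F x / (1 - (h x / R) ^ q)
        = ∑ j ∈ Finset.range q, ((R : ℂ) * ζ ^ j / q) * (F x / ((R : ℂ) * ζ ^ j - h x)) := by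
      have h1 := hζ.sum_pow_div_pow_sub hq hwq
      have h2 : F x / (1 - (h x / R) ^ q) = F x / q * (q / (1 - (h x / R) ^ q)) := by
        field_simp
      rw [h2, ← h1, Finset.mul_sum]
      refine Finset.sum_congr rfl fun j _ => ?_
      have h3 : ζ ^ j - h x / R = ((R : ℂ) * ζ ^ j - h x) / R := by field_simp
      rw [h3]
      have := hdne j
      field_simp
    rw [hsum, ← Finset.sum_sub_distrib]
    have : ∀ j ∈ Finset.range q, ‖((R : ℂ) * ζ ^ j / q) * a j x
        - ((R : ℂ) * ζ ^ j / q) * (F x / ((R : ℂ) * ζ ^ j - h x))‖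
        ≤ R / q * (ε / |‖h x‖ - R|) := fun j _ => by
      have h1 : a j x - F x / ((R : ℂ) * ζ ^ j - h x)
          = -(F x - ((R : ℂ) * ζ ^ j - h x) * a j x) / ((R : ℂ) * ζ ^ j - h x) := by
        have := hdne j
        field_simp
        ring
      have h2 := (haK j x hx).1
      rw [← mul_sub, norm_mul, hcoef, h1, norm_div, norm_neg]
      have h3 : 0 ≤ ε := (norm_nonneg _).trans h2
      gcongr
      exact hdist j
    refine (norm_sum_le_of_le _ this).trans_eq ?_
    rw [Finset.sum_const, Finset.card_range, nsmul_eq_mul]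
    field_simp

theorem exists_cutoff [CompactSpace X] {K : Set X} {F h : C(X, ℂ)} {R C ε δ : ℝ} (hR : 1 ≤ R)
    (hR2 : R ≤ 2) (hδ : 0 < δ) (hε : 0 < ε)
    (H : ∀ z : ℂ, ‖z‖ = R → ∃ a ∈ A, ∀ x ∈ K, ‖F x - (z - h x) * a x‖ ≤ ε ∧ ‖a x‖ ≤ C) :
    ∃ k ∈ A, ∀ x ∈ K, ‖k x‖ ≤ R * C ∧ (‖h x‖ ≤ R - δ → ‖k x - F x‖ ≤ (2 / δ + 1) * ε) ∧
      (R + δ ≤ ‖h x‖ → ‖k x‖ ≤ (2 / δ + 1) * ε) := by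
  have hR0 : 0 < R := by linarith
  set θ : ℝ := 1 / (1 + δ / 2) with hθ
  have hθ0 : 0 < θ := by positivity
  have hθ1 : θ < 1 := by rw [hθ, div_lt_one (by positivity)]; linarith
  have hlim := tendsto_pow_atTop_nhds_zero_of_lt_one hθ0.le hθ1
  obtain ⟨q, hq1, hq2, hq⟩ := ((hlim.eventually_le_const (show (0 : ℝ) < 1 / 2 by norm_num)).and
    ((hlim.eventually_le_const (show (0 : ℝ) < ε / (2 * (‖F‖ + 1)) by positivity)).and
      (Filter.eventually_ge_atTop 1))).exists
  obtain ⟨k, hk, hkK⟩ := exists_discrete_cauchy hR0 H hq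
  refine ⟨k, hk, fun x hx => ⟨(hkK x hx).1, ?_, ?_⟩⟩
  all_goals
    intro hhx
    have hne : ‖h x‖ ≠ R := by intro h1; linarith
    have h1 := (hkK x hx).2 hne
    have hFx := F.norm_coe_le_norm x
    have hF0 := norm_nonneg (F x)
    set t := θ ^ q with ht
    have ht0 : 0 < t := by positivity
    have hw : ‖(h x / R) ^ q‖ = (‖h x‖ / R) ^ q := by
      rw [norm_pow, norm_div, Complex.norm_real, Real.norm_of_nonneg hR0.le]
    have h2 : R * ε / |‖h x‖ - R| ≤ 2 / δ * ε := by
      have h3 : δ ≤ |‖h x‖ - R| := by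
        rw [le_abs]
        first | (left; linarith) | (right; linarith)
      rw [div_mul_eq_mul_div]
      gcongr
    have h4 : 2 * t * ‖F x‖ ≤ ε := by
      rw [le_div_iff₀ (by positivity)] at hq2
      nlinarith
  · have h5 : ‖(h x / R) ^ q‖ ≤ t := by
      rw [hw, ht]
      gcongr
      rw [hθ, div_le_div_iff₀ hR0 (by positivity)]
      nlinarith [norm_nonneg (h x)]
    have h6 : 1 / 2 ≤ ‖1 - (h x / R) ^ q‖ := by
      have := norm_sub_norm_le (1 : ℂ) ((h x / R) ^ q)
      rw [norm_one] at this
      linarith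
    have h7 : 1 - (h x / R) ^ q ≠ 0 := norm_pos_iff.mp (by linarith)
    have h8 : ‖F x / (1 - (h x / R) ^ q) - F x‖ ≤ ε := by
      have : F x / (1 - (h x / R) ^ q) - F x = F x * (h x / R) ^ q / (1 - (h x / R) ^ q) := by
        field_simp
        ring
      rw [this, norm_div, norm_mul, div_le_iff₀ (by linarith)]
      nlinarith
    calc _ = ‖(k x - F x / (1 - (h x / R) ^ q)) + (F x / (1 - (h x / R) ^ q) - F x)‖ := by
          congr 1; ring
      _ ≤ _ := norm_add_le _ _
      _ ≤ _ := by linarith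
  · have h5 : 1 / t ≤ ‖(h x / R) ^ q‖ := by
      rw [hw, ht, ← one_div_pow]
      refine pow_le_pow_left₀ (by positivity) ?_ q
      rw [hθ, one_div_one_div, le_div_iff₀ hR0]
      nlinarith
    have h6 : 1 / (2 * t) ≤ ‖1 - (h x / R) ^ q‖ := by
      have h7 := norm_sub_norm_le ((h x / R) ^ q) (1 : ℂ)
      rw [norm_one, norm_sub_rev] at h7
      have h9 : 1 / t = 1 / (2 * t) + 1 / (2 * t) := by field_simp; norm_num
      have h10 : 1 ≤ 1 / (2 * t) := by rw [le_div_iff₀ (by positivity)]; linarith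
      linarith
    have h8 : ‖F x / (1 - (h x / R) ^ q)‖ ≤ ε := by
      rw [norm_div]
      calc _ ≤ ‖F x‖ / (1 / (2 * t)) := by gcongr
        _ ≤ ε := by rw [div_div_eq_mul_div, div_one]; linarith
    calc _ = ‖(k x - F x / (1 - (h x / R) ^ q)) + F x / (1 - (h x / R) ^ q)‖ := by
          congr 1; ring
      _ ≤ _ := norm_add_le _ _
      _ ≤ _ := by linarith

end Cutoff

/-- Every function of `A` is dominated at each point of `K` by its value at some point of `T`. -/
def IsBoundaryOn {X : Type*} [TopologicalSpace X] (A : Subalgebra ℂ C(X, ℂ)) (T K : Set X) : Prop :=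
  ∀ g ∈ A, ∀ x ∈ K, ∃ t ∈ T, ‖g x‖ ≤ ‖g t‖

theorem norm_prod_le_of_forall_ne {ι : Type*} [Fintype ι] [DecidableEq ι] (v : ι → ℂ) {β Γ : ℝ}
    (i : ι) (hΓ : ‖v i‖ ≤ Γ) (hβ : ∀ j, j ≠ i → ‖v j‖ ≤ β) :
    ‖∏ j, v j‖ ≤ Γ * β ^ (Fintype.card ι - 1) := by
  rw [norm_prod, ← Finset.mul_prod_erase _ _ (Finset.mem_univ i)]
  have h1 : ∏ j ∈ Finset.univ.erase i, ‖v j‖ ≤ β ^ (Fintype.card ι - 1) := by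
    refine (Finset.prod_le_prod (fun j _ => norm_nonneg _)
      fun j hj => hβ j (Finset.ne_of_mem_erase hj)).trans_eq ?_
    rw [Finset.prod_const, Finset.card_erase_of_mem (Finset.mem_univ i), Finset.card_univ]
  exact mul_le_mul hΓ h1 (Finset.prod_nonneg fun j _ => norm_nonneg _)
    ((norm_nonneg _).trans hΓ)

section Boundary

variable {X : Type*} [TopologicalSpace X] [CompactSpace X] {A : Subalgebra ℂ C(X, ℂ)}

theorem exists_collar {K : Set X} (hK : IsClosed K) (f h : C(X, ℂ))
    (hf1 : ∀ x ∈ K, ‖h x‖ = 1 → ‖f x‖ < 1) :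
    ∃ η : ℝ, 0 < η ∧ η ≤ 1 ∧ ∀ x ∈ K, 1 ≤ ‖h x‖ → ‖h x‖ ≤ 1 + η → ‖f x‖ < 1 := by
  have hF : IsClosed {x | x ∈ K ∧ 1 ≤ ‖f x‖ ∧ 1 ≤ ‖h x‖} :=
    hK.inter ((isClosed_le continuous_const f.continuous.norm).inter
      (isClosed_le continuous_const h.continuous.norm))
  rcases Set.eq_empty_or_nonempty {x | x ∈ K ∧ 1 ≤ ‖f x‖ ∧ 1 ≤ ‖h x‖} with he | hne
  · refine ⟨1, one_pos, le_rfl, fun x hx h1 _ => ?_⟩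
    by_contra! h2
    exact (he ▸ (⟨hx, h2, h1⟩ : x ∈ {x | x ∈ K ∧ 1 ≤ ‖f x‖ ∧ 1 ≤ ‖h x‖}) : x ∈ (∅ : Set X))
  · obtain ⟨y, hy, hmin⟩ := hF.isCompact.exists_isMinOn hne (f := fun x => ‖h x‖) (by fun_prop)
    have hy1 : 1 < ‖h y‖ := lt_of_le_of_ne hy.2.2 fun h1 => absurd (hf1 y hy.1 h1.symm) hy.2.1.not_gt
    refine ⟨min 1 ((‖h y‖ - 1) / 2), lt_min one_pos (by linarith), min_le_left _ _,
      fun x hx h1 h2 => ?_⟩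
    by_contra! h3
    have h4 : ‖h y‖ ≤ ‖h x‖ := hmin (show x ∈ {x | x ∈ K ∧ 1 ≤ ‖f x‖ ∧ 1 ≤ ‖h x‖} from ⟨hx, h3, h1⟩)
    have := min_le_right 1 ((‖h y‖ - 1) / 2)
    linarith

theorem exists_pow_norm_le_half {T : Set X} (hT : IsClosed T) (f : C(X, ℂ))
    (hf : ∀ x ∈ T, ‖f x‖ < 1) : ∃ m : ℕ, 1 ≤ m ∧ ∀ x ∈ T, ‖f x‖ ^ m ≤ 1 / 2 := by
  rcases T.eq_empty_or_nonempty with rfl | hne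
  · exact ⟨1, le_rfl, by simp⟩
  obtain ⟨y, hy, hmax⟩ := hT.isCompact.exists_isMaxOn hne (f := fun x => ‖f x‖) (by fun_prop)
  have hlim := tendsto_pow_atTop_nhds_zero_of_lt_one (norm_nonneg (f y)) (hf y hy)
  obtain ⟨m, hm, hm1⟩ := ((hlim.eventually_le_const (show (0 : ℝ) < 1 / 2 by norm_num)).and
    (Filter.eventually_ge_atTop 1)).exists
  exact ⟨m, hm1, fun x hx => (pow_le_pow_left₀ (norm_nonneg _) (hmax hx) m).trans hm⟩

theorem exists_cutoff_prod {K T : Set X} (hTK : T ⊆ K) {F h : C(X, ℂ)} {x₀ : X} (hx₀ : x₀ ∈ K)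
    (hhx₀ : ‖h x₀‖ ≤ 1) (hFx₀ : ‖F x₀‖ = 1) {η C ε : ℝ} (hη : 0 < η) (hη1 : η ≤ 1) (hε : 0 < ε)
    (hFT : ∀ t ∈ T, ‖h t‖ ≤ 1 + η → ‖F t‖ ≤ ε) (L : ℕ)
    (H : ∀ z : ℂ, 1 ≤ ‖z‖ → ‖z‖ ≤ 1 + η →
      ∃ a ∈ A, ∀ x ∈ K, ‖F x - (z - h x) * a x‖ ≤ ε ∧ ‖a x‖ ≤ C)
    (hsmall : (4 * (L + 2) / η + 1) * ε ≤ 1 / 2) :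
    ∃ P ∈ A, (1 / 2) ^ (L + 1) ≤ ‖P x₀‖ ∧
      ∀ t ∈ T, ‖P t‖ ≤ 2 * C * ((4 * (L + 2) / η + 2) * ε) ^ L := by
  set δ : ℝ := η / (2 * (L + 2)) with hδ
  have hδ0 : 0 < δ := by positivity
  have hδη : 2 * δ * (L + 2) = η := by rw [hδ]; field_simp
  have hc : 2 / δ = 4 * (L + 2) / η := by rw [hδ]; field_simp; norm_num
  let R : Fin (L + 1) → ℝ := fun j => 1 + 2 * δ * ((j : ℕ) + 1)
  have hRlow (j) : 1 + 2 * δ ≤ R j := by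
    have : (0 : ℝ) ≤ (j : ℕ) := Nat.cast_nonneg _
    simp only [R]; nlinarith
  have hRup (j) : R j ≤ 1 + η := by
    have : ((j : ℕ) : ℝ) ≤ L := by exact_mod_cast Nat.lt_succ_iff.mp j.2
    simp only [R]; nlinarith
  have hC0 : 0 ≤ C := by
    obtain ⟨a, -, ha⟩ := H 1 (by simp) (by simpa using hη.le)
    exact (norm_nonneg _).trans (ha x₀ hx₀).2
  have hk (j : Fin (L + 1)) := exists_cutoff (A := A) (K := K) (F := F) (h := h) (R := R j) (C := C)
    (by linarith [hRlow j]) (by linarith [hRup j]) hδ0 hε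
    (fun z hz => H z (by linarith [hRlow j]) (by linarith [hRup j]))
  rw [hc] at hk
  choose k hkA hkK using hk
  have hev (x : X) : (∏ j, k j) x = ∏ j, k j x := by simp [ContinuousMap.prod_apply]
  refine ⟨∏ j, k j, A.prod_mem fun j _ => hkA j, ?_, fun t ht => ?_⟩
  · rw [hev, norm_prod]
    have : ∀ j ∈ (Finset.univ : Finset (Fin (L + 1))), 1 / 2 ≤ ‖k j x₀‖ := fun j _ => by
      have h1 := (hkK j x₀ hx₀).2.1 (by linarith [hRlow j])
      have h2 := norm_sub_norm_le (F x₀) (k j x₀)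
      rw [norm_sub_rev] at h2
      linarith
    simpa using Finset.prod_le_prod (fun j _ => by norm_num) this
  · rw [hev]
    have hgood (j : Fin (L + 1)) (hj : δ ≤ |‖h t‖ - R j|) :
        ‖k j t‖ ≤ (4 * (L + 2) / η + 2) * ε := by
      obtain ⟨-, hin, hout⟩ := hkK j t (hTK ht)
      rcases le_abs.mp hj with h1 | h1
      · linarith [hout (by linarith)]
      · have h2 := hin (by linarith)
        have h3 := hFT t ht (by linarith [hRup j])
        have h4 := norm_sub_norm_le (k j t) (F t)
        linarith
    have hall (j : Fin (L + 1)) : ‖k j t‖ ≤ 2 * C :=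
      (hkK j t (hTK ht)).1.trans (by gcongr; linarith [hRup j])
    obtain ⟨i, hi⟩ : ∃ i : Fin (L + 1), ∀ j, j ≠ i → δ ≤ |‖h t‖ - R j| := by
      by_contra! hcon
      obtain ⟨i, -, hi⟩ := hcon 0
      obtain ⟨j, hji, hj⟩ := hcon i
      have h1 : |R i - R j| < 2 * δ := by
        rw [abs_lt] at hi hj ⊢
        constructor <;> linarith [hi.1, hi.2, hj.1, hj.2]
      have h2 : R i - R j = 2 * δ * (((i : ℕ) : ℤ) - ((j : ℕ) : ℤ) : ℤ) := by
        simp only [R]; push_cast; ring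
      have h3 : (1 : ℝ) ≤ |((((i : ℕ) : ℤ) - ((j : ℕ) : ℤ) : ℤ) : ℝ)| := by
        have hne : (j : ℕ) ≠ i := fun h => hji (Fin.ext h)
        rw [← Int.cast_abs, ← Int.cast_one, Int.cast_le]
        exact Int.one_le_abs (by omega)
      rw [h2, abs_mul, abs_of_pos (by positivity)] at h1
      nlinarith
    have := norm_prod_le_of_forall_ne (fun j => k j t) i (hall i) fun j hj => hgood j (hi j hj)
    simpa using this

theorem IsBoundaryOn.false_of_lt_one
    (hnat : ∀ φ : A →ₐ[ℂ] ℂ, ∃ x : X, ∀ f : A, φ f = (f : C(X, ℂ)) x)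
    {K T : Set X} (hK : IsClosed K) (hKA : HullClosed A K) (hT : IsClosed T) (hTK : T ⊆ K)
    (hbd : IsBoundaryOn A T K) {f h : C(X, ℂ)} (hf : f ∈ A) (hh : h ∈ A) {x₀ : X} (hx₀ : x₀ ∈ K)
    (hhx₀ : ‖h x₀‖ ≤ 1) (hfx₀ : ‖f x₀‖ = 1) (hf1 : ∀ x ∈ K, ‖h x‖ = 1 → ‖f x‖ < 1)
    (hfT : ∀ t ∈ T, ‖h t‖ ≤ 1 → ‖f t‖ < 1) : False := by
  obtain ⟨η, hη, hη1, hcol⟩ := exists_collar hK f h hf1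
  obtain ⟨m, hm, hfm⟩ := exists_pow_norm_le_half
    (hT.inter (isClosed_le (f := fun x => ‖h x‖) (g := fun _ => 1 + η) (by fun_prop)
      continuous_const)) f (by
      rintro x ⟨hxT, hx⟩
      rcases le_total ‖h x‖ 1 with h1 | h1
      · exact hfT x hxT h1
      · exact hcol x (hTK hxT) h1 hx)
  have hW : IsCompact {z : ℂ | 1 ≤ ‖z‖ ∧ ‖z‖ ≤ 1 + η} := by
    refine (isCompact_closedBall (0 : ℂ) (1 + η)).of_isClosed_subset ?_ fun z hz => ?_
    · exact (isClosed_le continuous_const continuous_norm).inter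
        (isClosed_le continuous_norm continuous_const)
    · simpa using hz.2
  obtain ⟨N, hN, C, hNC⟩ := exists_uniform_pow_sub_mul_le (A.pow_mem hf m) hh hW (K := K)
    fun z hz => exists_pow_sub_mul_lt hnat hK hKA (A.pow_mem hf m) hh z fun x hx hxz => by
      rw [ContinuousMap.pow_apply, norm_pow]
      exact pow_lt_one₀ (norm_nonneg _)
        (hcol x hx (by rw [hxz]; exact hz.1) (by rw [hxz]; exact hz.2)) (by omega)
  set g := f ^ m with hg
  have hgA : g ∈ A := A.pow_mem hf m
  set M : ℝ := max 1 (‖g‖ ^ N) with hM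
  have hM1 : 1 ≤ M := le_max_left _ _
  have hC0 : 0 ≤ C := by
    obtain ⟨a, -, ha⟩ := hNC 1 (by simpa using hη.le)
    exact (norm_nonneg _).trans (ha x₀ hx₀).2
  obtain ⟨L, hL⟩ := pow_unbounded_of_one_lt (2 * M) (one_lt_two (α := ℝ))
  set c : ℝ := 4 * (L + 2) / η with hc
  have hc0 : 0 < c := by positivity
  have hlim1 : Filter.Tendsto (fun n : ℕ => (c + 1) * (1 / 2 : ℝ) ^ n) Filter.atTop (nhds 0) := by
    simpa using (tendsto_pow_atTop_nhds_zero_of_lt_one (show (0 : ℝ) ≤ 1 / 2 by norm_num)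
      (by norm_num)).const_mul (c + 1)
  have hlim2 : Filter.Tendsto (fun n : ℕ => (2 * C * (c + 2) ^ L) * (2 * M / 2 ^ L) ^ n)
      Filter.atTop (nhds 0) := by
    simpa using (tendsto_pow_atTop_nhds_zero_of_lt_one (show 0 ≤ 2 * M / 2 ^ L by positivity)
      ((div_lt_one (by positivity)).mpr hL)).const_mul (2 * C * (c + 2) ^ L)
  obtain ⟨n, hn1, hn2⟩ := ((hlim1.eventually_le_const (show (0 : ℝ) < 1 / 2 by norm_num)).and
    (hlim2.eventually_lt_const (show (0 : ℝ) < (1 / 2) ^ (L + 1) by positivity))).exists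
  obtain ⟨P, hPA, hPx₀, hPT⟩ := exists_cutoff_prod (A := A) hTK (F := g ^ (N * n)) hx₀ hhx₀
    (by rw [hg, ContinuousMap.pow_apply, ContinuousMap.pow_apply, norm_pow, norm_pow, hfx₀, one_pow,
      one_pow])
    (C := C * (2 * M) ^ n) hη hη1 (ε := (1 / 2) ^ n) (by positivity)
    (fun t ht hht => by
      rw [hg, ContinuousMap.pow_apply, ContinuousMap.pow_apply, norm_pow, norm_pow]
      calc _ ≤ (1 / 2 : ℝ) ^ (N * n) := by
            gcongr
            exact hfm t ⟨ht, hht⟩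
        _ ≤ _ := pow_le_pow_of_le_one (by norm_num) (by norm_num) (Nat.le_mul_of_pos_left n hN))
    L (fun z hz1 hz2 => by
      obtain ⟨a, ha, haK⟩ := hNC z ⟨hz1, hz2⟩
      obtain ⟨a', ha', ha'K⟩ := exists_pow_mul_sub_mul_le hgA hh ha hM1
        (fun x hx => le_max_of_le_right
          (pow_le_pow_left₀ (norm_nonneg _) (g.norm_coe_le_norm x) N)) (fun x hx => (haK x hx).1) n
      refine ⟨a', ha', fun x hx => ⟨(ha'K x hx).1, (ha'K x hx).2.trans ?_⟩⟩
      have hn : (n : ℝ) ≤ 2 ^ n := by exact_mod_cast Nat.lt_two_pow_self.le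
      rw [mul_pow]
      gcongr
      exact (haK x hx).2) hn1
  obtain ⟨t, ht, hPt⟩ := hbd P hPA x₀ hx₀
  have h1 := hPT t ht
  have h2 : 2 * (C * (2 * M) ^ n) * ((c + 2) * (1 / 2) ^ n) ^ L
      = (2 * C * (c + 2) ^ L) * (2 * M / 2 ^ L) ^ n := by
    rw [mul_pow (c + 2), div_pow (2 * M), ← pow_mul (2 : ℝ) L n, mul_comm L n, pow_mul (2 : ℝ) n L,
      one_div_pow (2 : ℝ) n, one_div_pow ((2 : ℝ) ^ n) L]
    ring
  rw [h2] at h1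
  linarith

theorem IsBoundaryOn.inter_disc
    (hnat : ∀ φ : A →ₐ[ℂ] ℂ, ∃ x : X, ∀ f : A, φ f = (f : C(X, ℂ)) x)
    {K T : Set X} (hK : IsClosed K) (hKA : HullClosed A K) (hT : IsClosed T) (hTK : T ⊆ K)
    (hbd : IsBoundaryOn A T K) {h : C(X, ℂ)} (hh : h ∈ A) :
    IsBoundaryOn A ((T ∩ {x | ‖h x‖ ≤ 1}) ∪ (K ∩ {x | ‖h x‖ = 1})) (K ∩ {x | ‖h x‖ ≤ 1}) := by
  rintro f hf x ⟨hxK, hhx⟩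
  by_contra! hcon
  have hno : ∀ g ∈ A, (∀ t ∈ (T ∩ {x | ‖h x‖ ≤ 1}) ∪ (K ∩ {x | ‖h x‖ = 1}), ‖g t‖ < ‖g x‖) →
      g x = 0 := by
    intro g hg hlt
    by_contra hgx
    have hpos : 0 < ‖g x‖ := norm_pos_iff.mpr hgx
    have hlt' : ∀ t ∈ (T ∩ {x | ‖h x‖ ≤ 1}) ∪ (K ∩ {x | ‖h x‖ = 1}), ‖((g x)⁻¹ • g) t‖ < 1 := by
      intro t ht
      rw [ContinuousMap.smul_apply, norm_smul, norm_inv, inv_mul_lt_one₀ hpos]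
      exact hlt t ht
    exact hbd.false_of_lt_one hnat hK hKA hT hTK (A.smul_mem hg (g x)⁻¹) hh hxK hhx
      (by rw [ContinuousMap.smul_apply, norm_smul, norm_inv, inv_mul_cancel₀ hpos.ne'])
      (fun y hy hhy => hlt' y (Or.inr ⟨hy, hhy⟩)) fun t ht hht => hlt' t (Or.inl ⟨ht, hht⟩)
  have hfx := hno f hf hcon
  have h1 := hno 1 A.one_mem fun t ht => by
    have := hcon t ht
    rw [hfx, norm_zero] at this
    exact absurd this (norm_nonneg _).not_gt
  simp at h1

theorem IsBoundaryOn.polyhedron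
    (hnat : ∀ φ : A →ₐ[ℂ] ℂ, ∃ x : X, ∀ f : A, φ f = (f : C(X, ℂ)) x)
    {S : Set X} (hS : IsClosed S) (hbd : IsBoundaryOn A S Set.univ) (s : Finset C(X, ℂ))
    (hs : ∀ h ∈ s, h ∈ A) :
    IsBoundaryOn A {x | (∀ h ∈ s, ‖h x‖ ≤ 1) ∧ (x ∈ S ∨ ∃ h ∈ s, ‖h x‖ = 1)}
      {x | ∀ h ∈ s, ‖h x‖ ≤ 1} := by
  classical
  suffices H : IsClosed {x | ∀ h ∈ s, ‖h x‖ ≤ 1} ∧ HullClosed A {x | ∀ h ∈ s, ‖h x‖ ≤ 1} ∧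
      IsClosed {x | (∀ h ∈ s, ‖h x‖ ≤ 1) ∧ (x ∈ S ∨ ∃ h ∈ s, ‖h x‖ = 1)} ∧
      IsBoundaryOn A {x | (∀ h ∈ s, ‖h x‖ ≤ 1) ∧ (x ∈ S ∨ ∃ h ∈ s, ‖h x‖ = 1)}
        {x | ∀ h ∈ s, ‖h x‖ ≤ 1} from H.2.2.2
  induction s using Finset.induction_on with
  | empty =>
    have hu : {x : X | ∀ h ∈ (∅ : Finset C(X, ℂ)), ‖h x‖ ≤ 1} = Set.univ := by simp
    have hS' : {x : X | (∀ h ∈ (∅ : Finset C(X, ℂ)), ‖h x‖ ≤ 1) ∧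
      (x ∈ S ∨ ∃ h ∈ (∅ : Finset C(X, ℂ)), ‖h x‖ = 1)} = S := by simp
    rw [hu, hS']
    exact ⟨isClosed_univ, fun x _ => Set.mem_univ x, hS, hbd⟩
  | insert h s hhs ih =>
    obtain ⟨hK, hKA, hT, hb⟩ := ih fun g hg => hs g (Finset.mem_insert_of_mem hg)
    have hhA : h ∈ A := hs h (Finset.mem_insert_self h s)
    set K := {x | ∀ h ∈ s, ‖h x‖ ≤ 1}
    set T := {x | (∀ h ∈ s, ‖h x‖ ≤ 1) ∧ (x ∈ S ∨ ∃ h ∈ s, ‖h x‖ = 1)}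
    have hK' : {x | ∀ g ∈ insert h s, ‖g x‖ ≤ 1} = K ∩ {x | ‖h x‖ ≤ 1} := by
      ext x
      simp only [Finset.forall_mem_insert, Set.mem_ofPred_eq, Set.mem_inter_iff, K]
      exact and_comm
    have hT' : {x | (∀ g ∈ insert h s, ‖g x‖ ≤ 1) ∧ (x ∈ S ∨ ∃ g ∈ insert h s, ‖g x‖ = 1)}
        = (T ∩ {x | ‖h x‖ ≤ 1}) ∪ (K ∩ {x | ‖h x‖ = 1}) := by
      ext x
      simp only [Finset.forall_mem_insert, Finset.exists_mem_insert, Set.mem_ofPred_eq,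
        Set.mem_inter_iff, Set.mem_union, K, T]
      constructor
      · rintro ⟨⟨h1, h2⟩, h3 | h3 | h3⟩
        · exact Or.inl ⟨⟨h2, Or.inl h3⟩, h1⟩
        · exact Or.inr ⟨h2, h3⟩
        · exact Or.inl ⟨⟨h2, Or.inr h3⟩, h1⟩
      · rintro (⟨⟨h1, h2 | h2⟩, h3⟩ | ⟨h1, h2⟩)
        · exact ⟨⟨h3, h1⟩, Or.inl h2⟩
        · exact ⟨⟨h3, h1⟩, Or.inr (Or.inr h2)⟩
        · exact ⟨⟨h2.le, h1⟩, Or.inr (Or.inl h2)⟩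
    have hD : IsClosed {x | ‖h x‖ ≤ 1} := isClosed_le (by fun_prop) continuous_const
    have hC : IsClosed {x | ‖h x‖ = 1} := isClosed_eq (by fun_prop) continuous_const
    rw [hK', hT']
    exact ⟨hK.inter hD, hKA.inter_disc hhA, (hT.inter hD).union (hK.inter hC),
      hb.inter_disc hnat hK hKA hT (fun x hx => hx.1) hhA⟩

end Boundary

section LocalMaximum

variable {X : Type*} [TopologicalSpace X] [CompactSpace X] {A : Subalgebra ℂ C(X, ℂ)}

theorem exists_finset_norm_lt_one (hsep : ∀ x y : X, x ≠ y → ∃ f ∈ A, f x ≠ f y) {U : Set X}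
    (hU : IsOpen U) {p : X} (hp : p ∈ U) :
    ∃ s : Finset C(X, ℂ), (∀ h ∈ s, h ∈ A) ∧ (∀ h ∈ s, ‖h p‖ < 1) ∧
      {x | ∀ h ∈ s, ‖h x‖ ≤ 1} ⊆ U := by
  have hex (y : X) (hy : y ∈ Uᶜ) : ∃ h ∈ A, ‖h p‖ < 1 ∧ 1 < ‖h y‖ := by
    obtain ⟨f, hf, hne⟩ := hsep y p fun h => hy (h ▸ hp)
    have hne' : f y - f p ≠ 0 := sub_ne_zero.mpr hne
    refine ⟨(2 / (f y - f p)) • (f - algebraMap ℂ C(X, ℂ) (f p)),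
      A.smul_mem (A.sub_mem hf (A.algebraMap_mem _)) _, ?_, ?_⟩
    · simp
    · simp [hne']
  choose! h hA h0 h1 using hex
  obtain ⟨t, ht, hcov⟩ := hU.isClosed_compl.isCompact.elim_nhds_subcover
    (fun y => {x | 1 < ‖h y x‖}) fun y hy =>
      (isOpen_lt continuous_const (h y).continuous.norm).mem_nhds (h1 y hy)
  classical
  refine ⟨t.image h, ?_, ?_, fun x hx => ?_⟩
  · simpa using fun y hy => hA y (ht y hy)
  · simpa using fun y hy => h0 y (ht y hy)
  · by_contra hxU
    obtain ⟨y, hy, hlt⟩ := Set.mem_iUnion₂.mp (hcov hxU)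
    exact (hx (h y) (Finset.mem_image_of_mem h hy)).not_gt hlt

theorem exists_minimal_isBoundaryOn (A : Subalgebra ℂ C(X, ℂ)) {Y : Set X} (hY : IsClosed Y) :
    ∃ T, Minimal (fun T => IsClosed T ∧ T ⊆ Y ∧ IsBoundaryOn A T Y) T := by
  obtain ⟨T, -, hT⟩ := zorn_superset_nonempty {T | IsClosed T ∧ T ⊆ Y ∧ IsBoundaryOn A T Y}
    (fun c hc hchain hne => by
      refine ⟨⋂₀ c, ⟨isClosed_sInter fun t ht => (hc ht).1, ?_, fun g hg x hx => ?_⟩,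
        fun t ht => Set.sInter_subset_of_mem ht⟩
      · obtain ⟨t, ht⟩ := hne
        exact (Set.sInter_subset_of_mem ht).trans (hc ht).2.1
      · have := hne.to_subtype
        have hcl (t : c) : IsClosed (t ∩ {y | ‖g x‖ ≤ ‖g y‖}) :=
          (hc t.2).1.inter (isClosed_le continuous_const g.continuous.norm)
        obtain ⟨y, hy⟩ := IsCompact.nonempty_iInter_of_directed_nonempty_isCompact_isClosed
          (fun t : c => (t : Set X) ∩ {y | ‖g x‖ ≤ ‖g y‖})
          (fun a b => by
            rcases hchain.total a.2 b.2 with h | h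
            · exact ⟨a, subset_rfl, Set.inter_subset_inter_left _ h⟩
            · exact ⟨b, Set.inter_subset_inter_left _ h, subset_rfl⟩)
          (fun t => (hc t.2).2.2 g hg x hx) (fun t => (hcl t).isCompact) hcl
        rw [Set.mem_iInter] at hy
        exact ⟨y, fun t ht => (hy ⟨t, ht⟩).1, (hy ⟨_, hne.some_mem⟩).2⟩)
    Y ⟨hY, subset_rfl, fun g _ x hx => ⟨x, hx, le_rfl⟩⟩
  exact ⟨T, hT⟩

theorem exists_norm_eq_one_of_not_isBoundaryOn {Y T : Set X} (hY : IsClosed Y)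
    (hT : ¬ IsBoundaryOn A T Y) :
    ∃ g ∈ A, (∀ t ∈ T, ‖g t‖ < 1) ∧ (∀ y ∈ Y, ‖g y‖ ≤ 1) ∧ ∃ y ∈ Y, ‖g y‖ = 1 := by
  unfold IsBoundaryOn at hT
  push Not at hT
  obtain ⟨g, hg, x, hx, hlt⟩ := hT
  rcases T.eq_empty_or_nonempty with rfl | ⟨t₀, ht₀⟩
  · exact ⟨1, A.one_mem, by simp, by simp, x, hx, by simp⟩
  obtain ⟨y, hy, hmax⟩ := hY.isCompact.exists_isMaxOn ⟨x, hx⟩ (f := fun x => ‖g x‖) (by fun_prop)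
  have hxy : ‖g x‖ ≤ ‖g y‖ := hmax hx
  have hpos : 0 < ‖g y‖ := ((norm_nonneg _).trans_lt (hlt t₀ ht₀)).trans_le hxy
  have hnorm (z : X) : ‖((g y)⁻¹ • g) z‖ = ‖g y‖⁻¹ * ‖g z‖ := by
    rw [ContinuousMap.smul_apply, norm_smul, norm_inv]
  refine ⟨(g y)⁻¹ • g, A.smul_mem hg _, fun t ht => ?_, fun z hz => ?_, y, hy, ?_⟩
  · rw [hnorm, inv_mul_lt_one₀ hpos]
    exact (hlt t ht).trans_le hxy
  · rw [hnorm, inv_mul_le_one₀ hpos]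
    exact hmax hz
  · rw [hnorm, inv_mul_cancel₀ hpos.ne']

theorem IsBoundaryOn.norm_lt_one_of_norm_eq_one {Y T : Set X} (hT : IsClosed T) (hTY : T ⊆ Y)
    (hbd : IsBoundaryOn A T Y) {V : Set X} (hV : IsOpen V) {g h : C(X, ℂ)} (hg : g ∈ A)
    (hh : h ∈ A) (hgY : ∀ y ∈ Y, ‖g y‖ ≤ 1) (hgT : ∀ t ∈ T \ V, ‖g t‖ < 1)
    (hhV : ∀ x ∈ V, ‖h x‖ < 1) {y : X} (hy : y ∈ Y) (hgy : ‖g y‖ = 1) : ‖h y‖ < 1 := by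
  obtain ⟨m, -, hm⟩ := exists_pow_norm_le_half (hT.sdiff hV) g hgT
  have hlim : Filter.Tendsto (fun n : ℕ => (1 / 2 : ℝ) ^ n * ‖h‖) Filter.atTop (nhds 0) := by
    simpa using (tendsto_pow_atTop_nhds_zero_of_lt_one (show (0 : ℝ) ≤ 1 / 2 by norm_num)
      (by norm_num)).mul_const ‖h‖
  obtain ⟨n, hn⟩ := (hlim.eventually_lt_const one_pos).exists
  have hnorm (x : X) : ‖((g ^ m) ^ n * h) x‖ = (‖g x‖ ^ m) ^ n * ‖h x‖ := by
    rw [ContinuousMap.mul_apply, norm_mul, ContinuousMap.pow_apply, ContinuousMap.pow_apply,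
      norm_pow, norm_pow]
  obtain ⟨t, ht, hle⟩ := hbd ((g ^ m) ^ n * h)
    (A.mul_mem (A.pow_mem (A.pow_mem hg m) n) hh) y hy
  rw [hnorm, hnorm, hgy, one_pow, one_pow, one_mul] at hle
  refine hle.trans_lt ?_
  by_cases htV : t ∈ V
  · refine lt_of_le_of_lt ?_ (hhV t htV)
    exact mul_le_of_le_one_left (norm_nonneg _)
      (pow_le_one₀ (by positivity) (pow_le_one₀ (norm_nonneg _) (hgY t (hTY ht))))
  · refine lt_of_le_of_lt ?_ hn
    gcongr
    · exact hm t ⟨ht, htV⟩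
    · exact h.norm_coe_le_norm t

/-- The local maximum modulus principle for a natural algebra `A`: on a closed set `Y` disjoint from
a closed boundary, every function of `A` attains its maximum modulus outside any given open subset
of `Y`. -/
theorem IsBoundaryOn.local_maximum_principle
    (hnat : ∀ φ : A →ₐ[ℂ] ℂ, ∃ x : X, ∀ f : A, φ f = (f : C(X, ℂ)) x)
    (hsep : ∀ x y : X, x ≠ y → ∃ f ∈ A, f x ≠ f y) {S : Set X} (hS : IsClosed S)
    (hbd : IsBoundaryOn A S Set.univ) {U Y : Set X} (hU : IsOpen U) (hY : IsClosed Y) (hUY : U ⊆ Y)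
    (hYS : Disjoint Y S) {u : C(X, ℂ)} (hu : u ∈ A) {x : X} (hx : x ∈ Y) :
    ∃ y ∈ Y \ U, ‖u x‖ ≤ ‖u y‖ := by
  by_contra! hcon
  obtain ⟨T, ⟨hT, hTY, hTbd⟩, hmin⟩ := exists_minimal_isBoundaryOn A hY
  obtain ⟨p, hpT, hle⟩ := hTbd u hu x hx
  have hpU : p ∈ U := by
    by_contra hpU
    exact (hcon p ⟨hTY hpT, hpU⟩).not_ge hle
  obtain ⟨s, hsA, hsp, hsU⟩ := exists_finset_norm_lt_one hsep hU hpU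
  have hV : IsOpen {x | ∀ h ∈ s, ‖h x‖ < 1} := by
    simp only [Set.ofPred_forall]
    exact isOpen_biInter_finset fun h _ => isOpen_lt h.continuous.norm continuous_const
  have hnot : ¬ IsBoundaryOn A (T \ {x | ∀ h ∈ s, ‖h x‖ < 1}) Y := fun hb =>
    (hmin ⟨hT.sdiff hV, Set.sdiff_subset.trans hTY, hb⟩ Set.sdiff_subset hpT).2 hsp
  obtain ⟨g, hg, hgT, hgY, y, hy, hgy⟩ := exists_norm_eq_one_of_not_isBoundaryOn hY hnot
  have hlt (z : X) (hz : z ∈ Y) (hgz : ‖g z‖ = 1) (h : C(X, ℂ)) (hh : h ∈ s) : ‖h z‖ < 1 :=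
    hTbd.norm_lt_one_of_norm_eq_one hT hTY hV hg (hsA h hh) hgY hgT (fun w hw => hw h hh) hz hgz
  obtain ⟨t, ⟨hts, ht⟩, hgt⟩ := hbd.polyhedron hnat hS s hsA g hg y
    fun h hh => (hlt y hy hgy h hh).le
  have htY : t ∈ Y := hUY (hsU hts)
  rw [hgy] at hgt
  rcases ht with ht | ⟨h, hh, ht⟩
  · exact Set.disjoint_left.mp hYS htY ht
  · exact (hlt t htY (le_antisymm (hgY t htY) hgt) h hh).ne ht

theorem isBoundaryOn_univ_of_sSup_eq {S : Set X} (hS : IsClosed S)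
    (hSbound : ∀ f ∈ A, sSup ((fun x => ‖f x‖) '' S) = sSup ((fun x => ‖f x‖) '' Set.univ)) :
    IsBoundaryOn A S Set.univ := by
  intro g hg x hx
  have hne : S.Nonempty := by
    by_contra hS0
    rw [Set.not_nonempty_iff_eq_empty] at hS0
    have := hSbound 1 A.one_mem
    simp [hS0, Set.image_univ, Set.range_const, (⟨x⟩ : Nonempty X)] at this
  obtain ⟨t, ht, hmax⟩ := hS.isCompact.exists_isMaxOn hne (f := fun x => ‖g x‖) (by fun_prop)
  refine ⟨t, ht, ?_⟩
  calc ‖g x‖ ≤ sSup ((fun x => ‖g x‖) '' Set.univ) :=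
        le_csSup (isCompact_univ.image g.continuous.norm).bddAbove ⟨x, hx, rfl⟩
    _ = sSup ((fun x => ‖g x‖) '' S) := (hSbound g hg).symm
    _ ≤ ‖g t‖ := csSup_le (hne.image _) (by rintro _ ⟨y, hy, rfl⟩; exact hmax hy)

theorem exists_isOpen_of_disjoint_connectedComponentIn [T2Space X] {Z S : Set X} (hZ : IsClosed Z)
    (hS : IsClosed S) {x : X} (hx : x ∈ Z) (hxS : Disjoint (connectedComponentIn Z x) S) :
    ∃ U, IsOpen U ∧ x ∈ U ∧ Disjoint (closure U) S ∧ Disjoint (closure U \ U) Z := by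
  have : CompactSpace Z := isCompact_iff_compactSpace.mp hZ.isCompact
  have hS' : IsCompact ((↑) ⁻¹' S : Set Z) := (hS.preimage continuous_subtype_val).isCompact
  rw [connectedComponentIn_eq_image hx, connectedComponent_eq_iInter_isClopen] at hxS
  obtain ⟨t, ht⟩ := hS'.elim_finite_subfamily_closed
    (fun E : { E : Set Z // IsClopen E ∧ ⟨x, hx⟩ ∈ E } => (E : Set Z)) (fun E => E.2.1.isClosed) (by
      rw [← Set.disjoint_iff_inter_eq_empty, disjoint_comm]
      exact Set.disjoint_image_left.mp hxS)
  set E : Set Z := ⋂ i ∈ t, (i : Set Z) with hE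
  have hEc : IsClopen E := isClopen_biInter_finset fun i _ => i.2.1
  have hxE : (⟨x, hx⟩ : Z) ∈ E := Set.mem_iInter₂.mpr fun i _ => i.2.2
  have hemb := hZ.isClosedEmbedding_subtypeVal
  have hF : IsClosed ((↑) '' Eᶜ ∪ S : Set X) :=
    (hemb.isClosedMap _ hEc.compl.isClosed).union hS
  obtain ⟨U, hU, hEU, hUF⟩ := normal_exists_closure_subset (hemb.isClosedMap _ hEc.isClosed)
    hF.isOpen_compl (by
      rintro _ ⟨y, hy, rfl⟩ (⟨z, hz, hzy⟩ | hyS)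
      · exact hz (Subtype.ext hzy ▸ hy)
      · exact Set.notMem_empty y (ht ▸ ⟨hyS, hy⟩))
  refine ⟨U, hU, hEU ⟨_, hxE, rfl⟩, Set.disjoint_left.mpr fun y hy hyS => hUF hy (Or.inr hyS),
    Set.disjoint_left.mpr fun y hy hyZ => ?_⟩
  by_cases hyE : (⟨y, hyZ⟩ : Z) ∈ E
  · exact hy.2 (hEU ⟨_, hyE, rfl⟩)
  · exact hUF hy.1 (Or.inl ⟨_, hyE, rfl⟩)

theorem exists_pos_forall_le_norm {F : Set X} (hF : IsClosed F) (f : C(X, ℂ))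
    (hf : ∀ x ∈ F, f x ≠ 0) : ∃ δ : ℝ, 0 < δ ∧ ∀ x ∈ F, δ ≤ ‖f x‖ := by
  rcases F.eq_empty_or_nonempty with rfl | hne
  · exact ⟨1, one_pos, by simp⟩
  obtain ⟨y, hy, hmin⟩ := hF.isCompact.exists_isMinOn hne (f := fun x => ‖f x‖) (by fun_prop)
  exact ⟨‖f y‖, norm_pos_iff.mpr (hf y hy), fun x hx => hmin hx⟩

end LocalMaximum

/-- Let `X` be a compact Hausdorff space and `A` a natural uniform algebra on `X`
(a closed, point-separating subalgebra of `C(X, ℂ)` all of whose characters are point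
evaluations) with dense invertibles.  Let `S` be a Shilov boundary for `A`.  Then for
every `f ∈ A` with nonempty zero set `Z(f)`, every connected component of `Z(f)` meets
`S`. -/
theorem stmt8 (X : Type*) [TopologicalSpace X] [CompactSpace X] [T2Space X]
    (A : Subalgebra ℂ C(X, ℂ))
    (hclosed : IsClosed (A : Set C(X, ℂ)))
    (hsep : ∀ x y : X, x ≠ y → ∃ f ∈ A, f x ≠ f y)
    (hnat : ∀ φ : A →ₐ[ℂ] ℂ, ∃ x : X, ∀ f : A, φ f = (f : C(X, ℂ)) x)
    (hinv : Dense {f : A | IsUnit f})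
    (S : Set X) (hS : IsClosed S)
    (hSbound : ∀ f ∈ A, sSup ((fun x => ‖f x‖) '' S) = sSup ((fun x => ‖f x‖) '' Set.univ))
    (hSmin : ∀ T : Set X, IsClosed T →
      (∀ f ∈ A, sSup ((fun x => ‖f x‖) '' T) = sSup ((fun x => ‖f x‖) '' Set.univ)) →
      S ⊆ T) :
    ∀ f ∈ A, ({x : X | f x = 0}).Nonempty →
      ∀ x ∈ {x : X | f x = 0},
        (connectedComponentIn {x : X | f x = 0} x ∩ S).Nonempty := by
  rintro f hf - x hx
  by_contra hcon
  rw [Set.not_nonempty_iff_eq_empty, ← Set.disjoint_iff_inter_eq_empty] at hcon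
  have hZ : IsClosed {x : X | f x = 0} := isClosed_eq f.continuous continuous_const
  obtain ⟨U, hU, hxU, hUS, hUZ⟩ := exists_isOpen_of_disjoint_connectedComponentIn hZ hS hx hcon
  obtain ⟨δ, hδ, hfδ⟩ := exists_pos_forall_le_norm (isClosed_closure.sdiff hU) f
    fun y hy hy0 => Set.disjoint_left.mp hUZ hy hy0
  obtain ⟨g, hgf, hgu⟩ := Metric.dense_iff.mp hinv ⟨f, hf⟩ (δ / 2) (half_pos hδ)
  obtain ⟨v, hgv⟩ := hgu.exists_right_inv
  have hfg (y : X) : ‖f y - (g : C(X, ℂ)) y‖ < δ / 2 := by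
    rw [Metric.mem_ball, dist_comm, dist_eq_norm] at hgf
    exact (ContinuousMap.norm_coe_le_norm (f - (g : C(X, ℂ))) y).trans_lt hgf
  have hmul (y : X) : ‖(g : C(X, ℂ)) y‖ * ‖(v : C(X, ℂ)) y‖ = 1 := by
    have : (g : C(X, ℂ)) y * (v : C(X, ℂ)) y = 1 :=
      DFunLike.congr_fun (congrArg (Subtype.val : A → C(X, ℂ)) hgv) y
    rw [← norm_mul, this, norm_one]
  obtain ⟨y, hy, hle⟩ := (isBoundaryOn_univ_of_sSup_eq hS hSbound).local_maximum_principle hnat hsep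
    hS hU isClosed_closure subset_closure hUS v.2 (subset_closure hxU)
  have hgx : ‖(g : C(X, ℂ)) x‖ < δ / 2 := by
    have := hfg x
    rwa [show f x = 0 from hx, zero_sub, norm_neg] at this
  have hgy : δ / 2 < ‖(g : C(X, ℂ)) y‖ := by
    have := norm_sub_norm_le (f y) ((g : C(X, ℂ)) y)
    linarith [hfδ y hy, hfg y]
  have hvx : 0 < ‖(v : C(X, ℂ)) x‖ :=
    (norm_nonneg _).lt_of_ne fun h => by simpa [← h] using hmul x
  have : ‖(g : C(X, ℂ)) x‖ * ‖(v : C(X, ℂ)) x‖ < ‖(g : C(X, ℂ)) y‖ * ‖(v : C(X, ℂ)) y‖ :=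
    mul_lt_mul (hgx.trans hgy) hle hvx (norm_nonneg _)
  rw [hmul, hmul] at this
  exact this.false
end

section
/- There exists a nonempty compact set Y ⊆ ∂𝔻̄² with (0,0) ∈ Ŷ and P(Y) having dense invertibles, such that, setting X = Ŷ, the set Y is exactly the Shilov boundary of the polynomials on X: sup_{y ∈ Y} |p(y)| = sup_{x ∈ X} |p(x)| for every polynomial function p in the two complex coordinates, and every closed subset S of X satisfying sup_{x ∈ S} |p(x)| = sup_{x ∈ X} |p(x)| for all such polynomials p contains Y. In particular this Shilov boundary Y is a proper subset of X, since (0,0) ∈ X \ Y. -/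
open BoundedContinuousFunction Set

noncomputable def pev (q : MvPolynomial (Fin 2) ℂ) (z : ℂ × ℂ) : ℂ :=
  MvPolynomial.eval ![z.1, z.2] q

def bidisk : Set (ℂ × ℂ) := {z : ℂ × ℂ | ‖z.1‖ ≤ 1 ∧ ‖z.2‖ ≤ 1}

def polyHull (Y : Set (ℂ × ℂ)) : Set (ℂ × ℂ) :=
  {z : ℂ × ℂ | ∀ (q : MvPolynomial (Fin 2) ℂ) (M : ℝ),
    (∀ y ∈ Y, ‖pev q y‖ ≤ M) → ‖pev q z‖ ≤ M}

/-- The subalgebra of `Y →ᵇ ℂ` consisting of restrictions to `Y` of polynomial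
functions in the two complex coordinates. -/
noncomputable def polySub (Y : Set (ℂ × ℂ)) : Subalgebra ℂ (Y →ᵇ ℂ) where
  carrier := {f : Y →ᵇ ℂ | ∃ q : MvPolynomial (Fin 2) ℂ, ∀ y : Y, f y = pev q ↑y}
  mul_mem' := by
    rintro f g ⟨q, hq⟩ ⟨r, hr⟩
    exact ⟨q * r, fun y => by simp [pev, hq y, hr y]⟩
  one_mem' := ⟨1, fun y => by simp [pev]⟩
  add_mem' := by
    rintro f g ⟨q, hq⟩ ⟨r, hr⟩
    exact ⟨q + r, fun y => by simp [pev, hq y, hr y]⟩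
  zero_mem' := ⟨0, fun y => by simp [pev]⟩
  algebraMap_mem' := fun c => ⟨MvPolynomial.C c, fun y => by simp [pev]⟩

/-- `P(Y)`: the uniform closure of the polynomial restrictions, as a Banach algebra
(a closed subalgebra of the bounded continuous functions on `Y`). -/
noncomputable def PY (Y : Set (ℂ × ℂ)) : Subalgebra ℂ (Y →ᵇ ℂ) :=
  (polySub Y).topologicalClosure

theorem continuous_pev (q : MvPolynomial (Fin 2) ℂ) : Continuous (pev q) := by
  unfold pev
  refine (MvPolynomial.continuous_eval q).comp (continuous_pi fun i => ?_)
  fin_cases i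
  · exact continuous_fst
  · exact continuous_snd

theorem differentiable_pev (q : MvPolynomial (Fin 2) ℂ) : Differentiable ℂ (pev q) := by
  induction q using MvPolynomial.induction_on with
  | C a =>
    have : pev (MvPolynomial.C a) = fun _ => a := by ext z; simp [pev]
    rw [this]
    exact differentiable_const a
  | add p q hp hq =>
    have : pev (p + q) = pev p + pev q := by ext z; simp [pev]
    rw [this]
    exact hp.add hq
  | mul_X p i hp =>
    have : pev (p * MvPolynomial.X i) = pev p * fun z => ![z.1, z.2] i := by ext z; simp [pev]
    rw [this]
    refine hp.mul ?_
    fin_cases i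
    · exact differentiable_fst
    · exact differentiable_snd

theorem norm_add_sq_complex (a u : ℂ) :
    ‖a + u‖ ^ 2 = ‖a‖ ^ 2 + 2 * (starRingEnd ℂ a * u).re + ‖u‖ ^ 2 := by
  simp only [Complex.sq_norm, Complex.normSq_apply, Complex.add_re, Complex.add_im,
    Complex.mul_re, Complex.conj_re, Complex.conj_im]
  ring

/-- A continuous linear functional on `ℂ²` has a nonzero vector in its kernel. -/
theorem exists_ne_zero_map_eq_zero (L : ℂ × ℂ →L[ℂ] ℂ) : ∃ v : ℂ × ℂ, v ≠ 0 ∧ L v = 0 := by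
  by_cases h : L (0, 1) = 0
  · exact ⟨(0, 1), by simp, h⟩
  · refine ⟨(L (0, 1), -L (1, 0)), by simp [h], ?_⟩
    have : ((L (0, 1), -L (1, 0)) : ℂ × ℂ) = L (0, 1) • (1, 0) + (-L (1, 0)) • (0, 1) := by simp
    rw [this, map_add, map_smul, map_smul, smul_eq_mul, smul_eq_mul]
    ring

/-- The Levi form of the function below is positive in every direction tangent to the level sets
of `q`, so it has no local maximum. -/
theorem not_isLocalMax_re_add_normSq_sub {p q : ℂ × ℂ → ℂ} (hp : Differentiable ℂ p)
    (hq : Differentiable ℂ q) {ε K : ℝ} (hε : 0 < ε) (hK : 0 < K) (c : ℂ) (x : ℂ × ℂ) :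
    ¬ IsLocalMax
      (fun y : ℂ × ℂ => (p y).re + ε * (‖y.1‖ ^ 2 + ‖y.2‖ ^ 2) - K * ‖q y - c‖ ^ 2) x := by
  intro hmax
  obtain ⟨v, hv, hLv⟩ := exists_ne_zero_map_eq_zero (fderiv ℂ q x)
  set N : ℝ := ‖v.1‖ ^ 2 + ‖v.2‖ ^ 2 with hN
  have hNpos : 0 < N := by
    by_contra hcon
    have h1 : ‖v.1‖ ^ 2 = 0 := by nlinarith [sq_nonneg ‖v.1‖, sq_nonneg ‖v.2‖]
    have h2 : ‖v.2‖ ^ 2 = 0 := by nlinarith [sq_nonneg ‖v.1‖, sq_nonneg ‖v.2‖]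
    exact hv (Prod.ext (by simpa using h1) (by simpa using h2))
  set line : ℂ → ℂ × ℂ := fun t => x + t • v with hline
  have hline_diff : Differentiable ℂ line := by fun_prop
  have hline0 : line 0 = x := by simp [hline]
  set s : ℂ → ℂ := fun t => q (line t) - q x with hs
  have hs_diff : Differentiable ℂ s := (hq.comp hline_diff).sub_const _
  have hs_deriv : HasDerivAt s 0 0 := by
    have h1 : HasDerivAt line v 0 := by
      have := ((hasDerivAt_id (0 : ℂ)).smul_const v).const_add x
      rw [one_smul] at this
      exact this
    have h2 : HasFDerivAt q (fderiv ℂ q x) (line 0) := by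
      rw [hline0]; exact (hq x).hasFDerivAt
    have h3 := (h2.comp_hasDerivAt (0 : ℂ) h1).sub_const (q x)
    rw [hLv] at h3
    exact h3
  set h : ℂ → ℂ := fun t => p (line t) - p x
    + 2 * ε * (starRingEnd ℂ x.1 * (t * v.1) + starRingEnd ℂ x.2 * (t * v.2))
    - 2 * K * (starRingEnd ℂ (q x - c) * s t) with hh
  have hh_diff : Differentiable ℂ h := by
    have := hp.comp hline_diff
    have h' : Differentiable ℂ fun t => p (line t) := this
    fun_prop
  have hh0 : h 0 = 0 := by simp [hh, hs, hline]
  have hid : ∀ t : ℂ,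
      (p (line t)).re + ε * (‖(line t).1‖ ^ 2 + ‖(line t).2‖ ^ 2) - K * ‖q (line t) - c‖ ^ 2
      = (p x).re + ε * (‖x.1‖ ^ 2 + ‖x.2‖ ^ 2) - K * ‖q x - c‖ ^ 2
        + ((h t).re + ε * N * ‖t‖ ^ 2 - K * ‖s t‖ ^ 2) := by
    intro t
    have e1 : (line t).1 = x.1 + t * v.1 := by simp [hline]
    have e2 : (line t).2 = x.2 + t * v.2 := by simp [hline]
    have e3 : q (line t) - c = (q x - c) + s t := by simp [hs]
    have e4 : (h t).re = (p (line t)).re - (p x).re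
        + 2 * ε * ((starRingEnd ℂ x.1 * (t * v.1)).re + (starRingEnd ℂ x.2 * (t * v.2)).re)
        - 2 * K * (starRingEnd ℂ (q x - c) * s t).re := by
      have r1 : (2 * ε : ℂ) = ((2 * ε : ℝ) : ℂ) := by push_cast; ring
      have r2 : (2 * K : ℂ) = ((2 * K : ℝ) : ℂ) := by push_cast; ring
      simp only [hh, r1, r2, Complex.add_re, Complex.sub_re, Complex.re_ofReal_mul]
    rw [e1, e2, e3, norm_add_sq_complex, norm_add_sq_complex, norm_add_sq_complex (q x - c), e4,
      norm_mul, norm_mul, hN]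
    ring
  have hcont : Filter.Tendsto line (nhds 0) (nhds x) := by
    have := hline_diff.continuous.tendsto 0
    rwa [hline0] at this
  have hev1 := hcont.eventually hmax
  have hsmall : ∀ᶠ t in nhds (0 : ℂ), K * ‖s t‖ ^ 2 ≤ ε * N / 2 * ‖t‖ ^ 2 := by
    have hlo := hs_deriv.isLittleO
    have hη : 0 < Real.sqrt (ε * N / 2 / K) := Real.sqrt_pos.2 (by positivity)
    filter_upwards [hlo.def hη] with t ht
    have hs0 : s 0 = 0 := by simp [hs, hline]
    simp only [hs0, sub_zero, smul_zero] at ht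
    have := pow_le_pow_left₀ (norm_nonneg _) ht 2
    rw [mul_pow, Real.sq_sqrt (by positivity)] at this
    calc K * ‖s t‖ ^ 2 ≤ K * (ε * N / 2 / K * ‖t‖ ^ 2) := by gcongr
      _ = _ := by field_simp
  have hneg : ∀ᶠ t in nhds (0 : ℂ), (h t).re ≤ -(ε * N / 2 * ‖t‖ ^ 2) := by
    filter_upwards [hev1, hsmall] with t ht1 ht2
    rw [hid t] at ht1
    linarith
  have hexp_max : IsLocalMax (norm ∘ fun t => Complex.exp (h t)) 0 := by
    filter_upwards [hneg] with t ht
    simp only [Function.comp, Complex.norm_exp, hh0]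
    refine Real.exp_le_exp.2 (ht.trans ?_)
    have : 0 ≤ ε * N / 2 * ‖t‖ ^ 2 := by positivity
    simpa using this
  have hconst := Complex.eventually_eq_of_isLocalMax_norm
    (Filter.Eventually.of_forall fun t => (hh_diff.cexp) t) hexp_max
  obtain ⟨t, ⟨ht1, ht2⟩, ht0⟩ :=
    (((hconst.and hneg).filter_mono nhdsWithin_le_nhds).and
      (self_mem_nhdsWithin : {(0 : ℂ)}ᶜ ∈ nhdsWithin (0 : ℂ) {0}ᶜ)).exists
  have ht0' : 0 < ‖t‖ := norm_pos_iff.2 ht0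
  have h1 : ‖Complex.exp (h t)‖ = 1 := by rw [ht1, hh0]; simp
  rw [Complex.norm_exp, Real.exp_eq_one_iff] at h1
  have : 0 < ε * N / 2 * ‖t‖ ^ 2 := by positivity
  linarith

theorem bidisk_eq : bidisk = Metric.closedBall (0 : ℂ × ℂ) 1 := by
  ext z; simp [bidisk, Prod.norm_def]

theorem isCompact_bidisk : IsCompact bidisk := by
  rw [bidisk_eq]; exact isCompact_closedBall _ _

theorem zero_mem_interior_bidisk : ((0 : ℂ), (0 : ℂ)) ∈ interior bidisk := by
  rw [bidisk_eq]
  exact interior_mono Metric.ball_subset_closedBall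
    (by rw [Metric.isOpen_ball.interior_eq]; exact Metric.mem_ball_self one_pos)

theorem frontier_bidisk_subset : frontier bidisk ⊆ bidisk :=
  isCompact_bidisk.isClosed.frontier_subset

/-- Maximum principle for the level set of `q` through the origin. -/
theorem zero_mem_polyHull_frontier_inter {q : ℂ × ℂ → ℂ} (hq : Differentiable ℂ q) {δ : ℝ}
    (hδ : 0 < δ) :
    ((0 : ℂ), (0 : ℂ)) ∈ polyHull {y ∈ frontier bidisk | ‖q y - q (0, 0)‖ ≤ δ} := by
  intro P M hM
  by_contra! hlt
  set a : ℂ := pev P (0, 0) with ha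
  have ha0 : 0 < ‖a‖ ∨ M < 0 := by
    by_cases h : M < 0
    · exact Or.inr h
    · exact Or.inl (lt_of_le_of_lt (not_lt.1 h) hlt)
  set p : ℂ × ℂ → ℂ := fun y => starRingEnd ℂ a * (pev P y - a) with hp
  have hp_diff : Differentiable ℂ p := ((differentiable_pev P).sub_const a).const_mul _
  have hp_cont : Continuous p := hp_diff.continuous
  obtain ⟨B, hB⟩ := isCompact_bidisk.exists_bound_of_continuousOn hp_cont.continuousOn
  -- the gap between the value at the origin and the values near the level set
  obtain ⟨η, hη, hgap⟩ : ∃ η : ℝ, 0 < η ∧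
      ∀ y ∈ frontier bidisk, ‖q y - q (0, 0)‖ ≤ δ → (p y).re ≤ -η := by
    rcases ha0 with h0 | h0
    · refine ⟨‖a‖ * (‖a‖ - M), mul_pos h0 (sub_pos.2 hlt), fun y hy hyq => ?_⟩
      have h1 : ‖pev P y‖ ≤ M := hM y ⟨hy, hyq⟩
      have h2 : (p y).re = (starRingEnd ℂ a * pev P y).re - ‖a‖ ^ 2 := by
        rw [hp]
        simp only [mul_sub, Complex.sub_re, Complex.sq_norm, Complex.normSq_apply, Complex.mul_re,
          Complex.conj_re, Complex.conj_im]
        ring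
      have h3 : (starRingEnd ℂ a * pev P y).re ≤ ‖a‖ * M := by
        refine (Complex.re_le_norm _).trans ?_
        rw [norm_mul, Complex.norm_conj]
        gcongr
      rw [h2]
      nlinarith
    · refine ⟨1, one_pos, fun y hy hyq => ?_⟩
      exact absurd ((norm_nonneg _).trans (hM y ⟨hy, hyq⟩)) (not_le.2 h0)
  set ε : ℝ := η / 4 with hε
  have hεpos : 0 < ε := by positivity
  set K : ℝ := (|B| + η) / δ ^ 2 with hK
  have hKpos : 0 < K := by positivity
  set Ψ : ℂ × ℂ → ℝ := fun y =>
    (p y).re + ε * (‖y.1‖ ^ 2 + ‖y.2‖ ^ 2) - K * ‖q y - q (0, 0)‖ ^ 2 with hΨ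
  have hq_cont : Continuous q := hq.continuous
  have hΨ_cont : Continuous Ψ := by fun_prop
  obtain ⟨x, hx, hxmax⟩ := isCompact_bidisk.exists_isMaxOn
    ⟨_, interior_subset zero_mem_interior_bidisk⟩ hΨ_cont.continuousOn
  have hΨ0 : Ψ (0, 0) = 0 := by simp [hΨ, hp, ha]
  have hxnf : x ∉ frontier bidisk := by
    intro hxf
    have h1 : Ψ (0, 0) ≤ Ψ x := hxmax (interior_subset zero_mem_interior_bidisk)
    have h2 : ‖x.1‖ ^ 2 + ‖x.2‖ ^ 2 ≤ 2 := by
      have := hx.1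
      have := hx.2
      nlinarith [norm_nonneg x.1, norm_nonneg x.2]
    have h3 : ε * (‖x.1‖ ^ 2 + ‖x.2‖ ^ 2) ≤ η / 2 := by rw [hε]; nlinarith
    rw [hΨ0] at h1
    simp only [hΨ] at h1
    by_cases hc : ‖q x - q (0, 0)‖ ≤ δ
    · have := hgap x hxf hc
      have h4 : 0 ≤ K * ‖q x - q (0, 0)‖ ^ 2 := by positivity
      linarith
    · have h4 : |B| + η ≤ K * ‖q x - q (0, 0)‖ ^ 2 := by
        calc |B| + η = K * δ ^ 2 := by rw [hK]; field_simp
          _ ≤ _ := by gcongr; exact (not_le.1 hc).le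
      have h5 : (p x).re ≤ |B| := (Complex.re_le_norm _).trans ((hB x hx).trans (le_abs_self B))
      linarith
  have hxi : x ∈ interior bidisk := by
    by_contra hcon
    exact hxnf ⟨subset_closure hx, hcon⟩
  exact not_isLocalMax_re_add_normSq_sub hp_diff hq hεpos hKpos (q (0, 0)) x
    (hxmax.isLocalMax (mem_interior_iff_mem_nhds.1 hxi))

/-- A closed subset of `X` on which every polynomial attains its maximum modulus over `X`. -/
structure IsPolyBoundary (X S : Set (ℂ × ℂ)) : Prop where
  subset : S ⊆ X
  isClosed : IsClosed S
  exists_max : ∀ P : MvPolynomial (Fin 2) ℂ, ∃ s ∈ S, ∀ x ∈ X, ‖pev P x‖ ≤ ‖pev P s‖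

/-- The intersection of all closed boundaries. -/
def shilovBoundary (X : Set (ℂ × ℂ)) : Set (ℂ × ℂ) :=
  {z | z ∈ X ∧ ∀ S, IsPolyBoundary X S → z ∈ S}

theorem isPolyBoundary_self {X : Set (ℂ × ℂ)} (hX : IsCompact X) (hne : X.Nonempty) :
    IsPolyBoundary X X where
  subset := subset_rfl
  isClosed := hX.isClosed
  exists_max P := hX.exists_isMaxOn hne (continuous_pev P).norm.continuousOn

/-- If some boundary misses a ball, then removing that ball from any boundary leaves a boundary. -/
theorem IsPolyBoundary.diff_ball {X S E : Set (ℂ × ℂ)} (hX : IsCompact X)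
    (hS : IsPolyBoundary X S) (hE : IsPolyBoundary X E) {c : ℂ × ℂ} {r : ℝ} (hr : 0 < r)
    (hdisj : ∀ e ∈ E, e ∉ Metric.ball c r) : IsPolyBoundary X (S \ Metric.ball c r) := by
  refine ⟨sdiff_subset.trans hS.subset, hS.isClosed.sdiff Metric.isOpen_ball, ?_⟩
  by_contra! hcon
  obtain ⟨P, hP⟩ := hcon
  set T := S \ Metric.ball c r with hT
  have hTc : IsCompact T :=
    hX.of_isClosed_subset (hS.isClosed.sdiff Metric.isOpen_ball) (sdiff_subset.trans hS.subset)
  obtain ⟨P, e, he, m', hm'0, hm'm, hm, hm'⟩ : ∃ P : MvPolynomial (Fin 2) ℂ, ∃ e ∈ E, ∃ m' : ℝ,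
      0 ≤ m' ∧ m' < ‖pev P e‖ ∧ (∀ x ∈ X, ‖pev P x‖ ≤ ‖pev P e‖) ∧ ∀ s ∈ T, ‖pev P s‖ ≤ m' := by
    rcases T.eq_empty_or_nonempty with h0 | h0
    · obtain ⟨e, he, hmax⟩ := hE.exists_max 1
      exact ⟨1, e, he, 0, le_rfl, by simp [pev], hmax, by simp [h0]⟩
    · obtain ⟨e, he, hmax⟩ := hE.exists_max P
      obtain ⟨t, ht, htmax⟩ := hTc.exists_isMaxOn h0 (continuous_pev P).norm.continuousOn
      obtain ⟨x, hx, hlt⟩ := hP t ht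
      exact ⟨P, e, he, _, norm_nonneg _, hlt.trans_le (hmax x hx), hmax, fun s hs => htmax hs⟩
  set m := ‖pev P e‖ with hmdef
  have hm0 : 0 < m := hm'0.trans_lt hm'm
  obtain ⟨C, hC⟩ := hX.exists_bound_of_continuousOn
    (continuous_id.sub (continuous_const (y := c))).continuousOn
  obtain ⟨n, hn⟩ : ∃ n : ℕ, m' ^ n * |C| < m ^ n * r := by
    have h1 : Filter.Tendsto (fun n : ℕ => (m' / m) ^ n * |C|) Filter.atTop (nhds (0 * |C|)) :=
      (tendsto_pow_atTop_nhds_zero_of_lt_one (by positivity)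
        ((div_lt_one hm0).2 hm'm)).mul_const _
    rw [zero_mul] at h1
    obtain ⟨n, hn⟩ := (h1.eventually (gt_mem_nhds hr)).exists
    refine ⟨n, ?_⟩
    rw [div_pow, div_mul_eq_mul_div, div_lt_iff₀ (by positivity)] at hn
    linarith
  have key : ∀ (F : MvPolynomial (Fin 2) ℂ), (∀ x, ‖pev F x‖ ≤ ‖x - c‖) → ‖pev F e‖ < r := by
    intro F hF
    obtain ⟨s, hs, hmax⟩ := hS.exists_max (P ^ n * F)
    have hmul : ∀ x, ‖pev (P ^ n * F) x‖ = ‖pev P x‖ ^ n * ‖pev F x‖ := by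
      intro x; simp [pev]
    have h1 := hmax e (hE.subset he)
    rw [hmul, hmul] at h1
    have h2 : ‖pev P s‖ ^ n * ‖pev F s‖ < m ^ n * r := by
      by_cases hsU : s ∈ Metric.ball c r
      · have h3 : ‖pev F s‖ < r := (hF s).trans_lt (by simpa [dist_eq_norm] using hsU)
        calc ‖pev P s‖ ^ n * ‖pev F s‖ ≤ m ^ n * ‖pev F s‖ := by
              gcongr; exact hm s (hS.subset hs)
          _ < m ^ n * r := by gcongr
      · have h3 : ‖pev F s‖ ≤ |C| := (hF s).trans ((hC s (hS.subset hs)).trans (le_abs_self C))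
        calc ‖pev P s‖ ^ n * ‖pev F s‖ ≤ m' ^ n * |C| := by
              gcongr; exact hm' s ⟨hs, hsU⟩
          _ < m ^ n * r := hn
    exact lt_of_mul_lt_mul_left (h1.trans_lt h2) (by positivity)
  refine hdisj e he ?_
  have k1 := key (MvPolynomial.X 0 - MvPolynomial.C c.1) fun x => by
    simpa [pev] using norm_fst_le (x - c)
  have k2 := key (MvPolynomial.X 1 - MvPolynomial.C c.2) fun x => by
    simpa [pev] using norm_snd_le (x - c)
  rw [mem_ball_iff_norm, Prod.norm_def]
  simp only [pev, map_sub, MvPolynomial.eval_X, MvPolynomial.eval_C] at k1 k2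
  exact max_lt k1 k2

theorem isPolyBoundary_shilovBoundary {X : Set (ℂ × ℂ)} (hX : IsCompact X) (hne : X.Nonempty) :
    IsPolyBoundary X (shilovBoundary X) := by
  refine ⟨fun z hz => hz.1, ?_, fun P => ?_⟩
  · have : shilovBoundary X = X ∩ ⋂ S ∈ {S | IsPolyBoundary X S}, S := by
      ext z; simp [shilovBoundary]
    rw [this]
    exact hX.isClosed.inter (isClosed_biInter fun S hS => hS.isClosed)
  by_contra! hcon
  obtain ⟨x₀, hx₀, hmax⟩ := hX.exists_isMaxOn hne (continuous_pev P).norm.continuousOn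
  set K := X ∩ {x | ‖pev P x₀‖ ≤ ‖pev P x‖} with hK
  have hKc : IsCompact K :=
    hX.inter_right (isClosed_le continuous_const (continuous_pev P).norm)
  have hKX : ∀ x ∈ K, x ∉ shilovBoundary X := by
    intro x hx hxs
    obtain ⟨y, hy, hlt⟩ := hcon x hxs
    exact absurd (hx.2.trans_lt hlt) (not_lt.2 (hmax hy))
  have hremove : ∀ S, IsPolyBoundary X S → ∃ S', IsPolyBoundary X S' ∧ S' ⊆ S \ K := by
    refine hKc.induction_on (p := fun A => ∀ S, IsPolyBoundary X S →
      ∃ S', IsPolyBoundary X S' ∧ S' ⊆ S \ A) ?_ ?_ ?_ ?_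
    · exact fun S hS => ⟨S, hS, by simp⟩
    · intro A B hAB hB S hS
      obtain ⟨S', h1, h2⟩ := hB S hS
      exact ⟨S', h1, h2.trans (sdiff_subset_sdiff_right hAB)⟩
    · intro A B hA hB S hS
      obtain ⟨S', h1, h2⟩ := hA S hS
      obtain ⟨S'', h3, h4⟩ := hB S' h1
      exact ⟨S'', h3, fun z hz => ⟨(h2 (h4 hz).1).1,
        fun h => h.elim (h2 (h4 hz).1).2 (h4 hz).2⟩⟩
    · intro x hx
      obtain ⟨E, hE, hxE⟩ : ∃ E, IsPolyBoundary X E ∧ x ∉ E := by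
        have := hKX x hx
        by_contra! h
        exact this ⟨hx.1, h⟩
      obtain ⟨r, hr, hball⟩ := Metric.isOpen_iff.1 hE.isClosed.isOpen_compl x hxE
      exact ⟨Metric.ball x r, mem_nhdsWithin_of_mem_nhds (Metric.ball_mem_nhds x hr), fun S hS =>
        ⟨_, hS.diff_ball hX hE hr fun e he heb => hball heb he, subset_rfl⟩⟩
  obtain ⟨S', hS', hsub⟩ := hremove X (isPolyBoundary_self hX hne)
  obtain ⟨s, hs, hsmax⟩ := hS'.exists_max P
  exact (hsub hs).2 ⟨hS'.subset hs, hsmax x₀ hx₀⟩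

theorem IsPolyBoundary.sSup_eq {X S : Set (ℂ × ℂ)} (hS : IsPolyBoundary X S)
    (P : MvPolynomial (Fin 2) ℂ) :
    sSup ((fun z => ‖pev P z‖) '' S) = sSup ((fun z => ‖pev P z‖) '' X) := by
  obtain ⟨s, hs, hmax⟩ := hS.exists_max P
  have h1 : IsGreatest ((fun z => ‖pev P z‖) '' S) ‖pev P s‖ :=
    ⟨⟨s, hs, rfl⟩, by rintro _ ⟨y, hy, rfl⟩; exact hmax y (hS.subset hy)⟩
  have h2 : IsGreatest ((fun z => ‖pev P z‖) '' X) ‖pev P s‖ :=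
    ⟨⟨s, hS.subset hs, rfl⟩, by rintro _ ⟨y, hy, rfl⟩; exact hmax y hy⟩
  rw [h1.csSup_eq, h2.csSup_eq]

theorem isPolyBoundary_of_sSup_eq {X S : Set (ℂ × ℂ)} (hX : IsCompact X) (hne : X.Nonempty)
    (hSX : S ⊆ X) (hS : IsClosed S)
    (h : ∀ P : MvPolynomial (Fin 2) ℂ,
      sSup ((fun z => ‖pev P z‖) '' S) = sSup ((fun z => ‖pev P z‖) '' X)) :
    IsPolyBoundary X S := by
  have hSne : S.Nonempty := by
    by_contra! h0
    have := h 1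
    simp [h0, pev, hne] at this
  refine ⟨hSX, hS, fun P => ?_⟩
  obtain ⟨s, hs, hmax⟩ := (hX.of_isClosed_subset hS hSX).exists_isMaxOn hSne
    (continuous_pev P).norm.continuousOn
  refine ⟨s, hs, fun x hx => ?_⟩
  have h1 : IsGreatest ((fun z => ‖pev P z‖) '' S) ‖pev P s‖ :=
    ⟨⟨s, hs, rfl⟩, by rintro _ ⟨y, hy, rfl⟩; exact hmax hy⟩
  rw [← h1.csSup_eq, h P]
  exact le_csSup (hX.bddAbove_image (continuous_pev P).norm.continuousOn) ⟨x, hx, rfl⟩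

theorem subset_polyHull (Y : Set (ℂ × ℂ)) : Y ⊆ polyHull Y := fun y hy _ _ h => h y hy

theorem polyHull_mono {Y Z : Set (ℂ × ℂ)} (h : Y ⊆ Z) : polyHull Y ⊆ polyHull Z :=
  fun _ hz q M hM => hz q M fun y hy => hM y (h hy)

theorem isCompact_polyHull {Y : Set (ℂ × ℂ)} (hY : Y ⊆ bidisk) : IsCompact (polyHull Y) := by
  refine isCompact_bidisk.of_isClosed_subset ?_ fun z hz => ⟨?_, ?_⟩
  · have : polyHull Y = ⋂ (q : MvPolynomial (Fin 2) ℂ) (M : ℝ) (_ : ∀ y ∈ Y, ‖pev q y‖ ≤ M),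
        {z | ‖pev q z‖ ≤ M} := by
      ext z; simp [polyHull]
    rw [this]
    exact isClosed_iInter fun q => isClosed_iInter fun M => isClosed_iInter fun _ =>
      isClosed_le (continuous_pev q).norm continuous_const
  · simpa [pev] using hz (MvPolynomial.X 0) 1 fun y hy => by simpa [pev] using (hY hy).1
  · simpa [pev] using hz (MvPolynomial.X 1) 1 fun y hy => by simpa [pev] using (hY hy).2

theorem isPolyBoundary_polyHull {Y : Set (ℂ × ℂ)} (hY : IsCompact Y) (hne : Y.Nonempty) :
    IsPolyBoundary (polyHull Y) Y := by
  refine ⟨subset_polyHull Y, hY.isClosed, fun P => ?_⟩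
  obtain ⟨s, hs, hmax⟩ := hY.exists_isMaxOn hne (continuous_pev P).norm.continuousOn
  exact ⟨s, hs, fun x hx => hx P _ fun y hy => hmax hy⟩

theorem IsPolyBoundary.polyHull_eq {Y S : Set (ℂ × ℂ)} (hS : IsPolyBoundary (polyHull Y) S)
    (hSY : S ⊆ Y) : polyHull S = polyHull Y := by
  refine (polyHull_mono hSY).antisymm fun x hx q M hM => ?_
  obtain ⟨s, hs, hmax⟩ := hS.exists_max q
  exact (hmax x hx).trans (hM s hs)

/-- Entire functions with value `1` at the origin, each the exponential of a large multiple of the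
preceding one times a normalized polynomial. -/
noncomputable def tower (P : ℕ → MvPolynomial (Fin 2) ℂ) (M : ℕ → ℝ) : ℕ → ℂ × ℂ → ℂ
  | 0 => fun _ => 1
  | n + 1 => fun z =>
    Complex.exp (M n * (tower P M n z - 1)) * (pev (P n) z * (pev (P n) (0, 0))⁻¹)

theorem differentiable_tower (P : ℕ → MvPolynomial (Fin 2) ℂ) (M : ℕ → ℝ) (n : ℕ) :
    Differentiable ℂ (tower P M n) := by
  induction n with
  | zero => exact differentiable_const _
  | succ n ih =>
    exact ((ih.sub_const 1).const_mul _).cexp.mul ((differentiable_pev (P n)).mul_const _)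

theorem tower_zero {P : ℕ → MvPolynomial (Fin 2) ℂ} (M : ℕ → ℝ)
    (hP : ∀ n, pev (P n) (0, 0) ≠ 0) (n : ℕ) : tower P M n (0, 0) = 1 := by
  induction n with
  | zero => rfl
  | succ n ih => simp [tower, ih, hP n]

theorem exists_tower_exponent (P : MvPolynomial (Fin 2) ℂ) : ∃ M : ℝ, 0 ≤ M ∧
    ∀ z ∈ bidisk, Real.exp (-(M / 2)) * ‖pev P z * (pev P (0, 0))⁻¹‖ < 1 / 2 := by
  obtain ⟨B, hB⟩ := isCompact_bidisk.exists_bound_of_continuousOn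
    ((continuous_pev P).mul_const (pev P (0, 0))⁻¹).continuousOn
  refine ⟨4 * |B| + 2, by positivity, fun z hz => ?_⟩
  have h1 := hB z hz
  have h2 : 2 * |B| + 1 + 1 ≤ Real.exp (2 * |B| + 1) := Real.add_one_le_exp _
  have h3 : (4 * |B| + 2) / 2 = 2 * |B| + 1 := by ring
  rw [h3, Real.exp_neg, inv_mul_lt_iff₀ (Real.exp_pos _)]
  linarith [le_abs_self B]

theorem half_le_re_tower {P : ℕ → MvPolynomial (Fin 2) ℂ} {M : ℕ → ℝ} (hM0 : ∀ n, 0 ≤ M n)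
    (hM : ∀ n, ∀ z ∈ bidisk,
      Real.exp (-(M n / 2)) * ‖pev (P n) z * (pev (P n) (0, 0))⁻¹‖ < 1 / 2)
    {n : ℕ} {z : ℂ × ℂ} (hz : z ∈ bidisk) (h : 1 / 2 ≤ ‖tower P M (n + 1) z‖) :
    1 / 2 ≤ (tower P M n z).re := by
  by_contra! hlt
  have h1 : ‖tower P M (n + 1) z‖
      ≤ Real.exp (-(M n / 2)) * ‖pev (P n) z * (pev (P n) (0, 0))⁻¹‖ := by
    rw [tower, norm_mul, Complex.norm_exp]
    gcongr
    rw [Complex.re_ofReal_mul, Complex.sub_re, Complex.one_re]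
    nlinarith [hM0 n]
  linarith [hM n z hz]

/-- The part of the frontier of the bidisk on which every function in the tower has modulus at
least one half. -/
def towerSet (P : ℕ → MvPolynomial (Fin 2) ℂ) (M : ℕ → ℝ) : Set (ℂ × ℂ) :=
  {y ∈ frontier bidisk | ∀ n, 1 / 2 ≤ ‖tower P M n y‖}

theorem isCompact_towerSet (P : ℕ → MvPolynomial (Fin 2) ℂ) (M : ℕ → ℝ) :
    IsCompact (towerSet P M) := by
  refine isCompact_bidisk.of_isClosed_subset ?_ fun y hy => frontier_bidisk_subset hy.1
  have : towerSet P M = frontier bidisk ∩ ⋂ n, {y | 1 / 2 ≤ ‖tower P M n y‖} := by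
    ext y; simp [towerSet]
  rw [this]
  exact isClosed_frontier.inter (isClosed_iInter fun n =>
    isClosed_le continuous_const (differentiable_tower P M n).continuous.norm)

theorem zero_mem_polyHull_towerSet {P : ℕ → MvPolynomial (Fin 2) ℂ} {M : ℕ → ℝ}
    (hP : ∀ n, pev (P n) (0, 0) ≠ 0) (hM0 : ∀ n, 0 ≤ M n)
    (hM : ∀ n, ∀ z ∈ bidisk,
      Real.exp (-(M n / 2)) * ‖pev (P n) z * (pev (P n) (0, 0))⁻¹‖ < 1 / 2) :
    ((0 : ℂ), (0 : ℂ)) ∈ polyHull (towerSet P M) := by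
  intro Q C hC
  by_contra! hlt
  obtain ⟨C', hCC', hC'⟩ := exists_between hlt
  set A : ℕ → Set (ℂ × ℂ) := fun n =>
    {y ∈ frontier bidisk | 1 / 2 ≤ ‖tower P M n y‖ ∧ C' ≤ ‖pev Q y‖} with hA
  have hAclosed : ∀ n, IsClosed (A n) := fun n =>
    isClosed_frontier.inter
      ((isClosed_le continuous_const (differentiable_tower P M n).continuous.norm).inter
        (isClosed_le continuous_const (continuous_pev Q).norm))
  have hAmono : ∀ n, A (n + 1) ⊆ A n := fun n y hy =>
    ⟨hy.1, (half_le_re_tower hM0 hM (frontier_bidisk_subset hy.1) hy.2.1).trans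
      (Complex.re_le_norm _), hy.2.2⟩
  have hAne : ∀ n, (A n).Nonempty := by
    intro n
    by_contra! h0
    have h1 : ‖pev Q (0, 0)‖ ≤ C' := by
      refine zero_mem_polyHull_frontier_inter (differentiable_tower P M n)
        (one_half_pos (α := ℝ)) Q C' fun y hy => ?_
      by_contra! hy'
      have : y ∈ A n := by
        refine ⟨hy.1, ?_, hy'.le⟩
        have h2 := hy.2
        rw [tower_zero M hP n] at h2
        have h3 := norm_sub_norm_le (1 : ℂ) (tower P M n y)
        rw [norm_one, norm_sub_rev] at h3
        linarith
      rw [h0] at this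
      exact this
    linarith
  obtain ⟨y, hy⟩ := IsCompact.nonempty_iInter_of_sequence_nonempty_isCompact_isClosed A hAmono hAne
    (isCompact_bidisk.of_isClosed_subset (hAclosed 0) fun y hy => frontier_bidisk_subset hy.1)
    hAclosed
  rw [mem_iInter] at hy
  have h1 := hC y ⟨(hy 0).1, fun n => (hy n).2.1⟩
  linarith [(hy 0).2.2]

/-- The restriction of a polynomial as an element of `P(Y)`. -/
theorem exists_PY_eq_pev {Y : Set (ℂ × ℂ)} (hY : IsCompact Y) (Q : MvPolynomial (Fin 2) ℂ) :
    ∃ f : PY Y, ∀ y : Y, (f : Y →ᵇ ℂ) y = pev Q y := by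
  have : CompactSpace Y := isCompact_iff_compactSpace.1 hY
  refine ⟨⟨BoundedContinuousFunction.mkOfCompact
    ⟨fun y : Y => pev Q y, (continuous_pev Q).comp continuous_subtype_val⟩, ?_⟩, fun y => rfl⟩
  exact (polySub Y).le_topologicalClosure ⟨Q, fun y => rfl⟩

/-- Evaluation at a point, as a ring homomorphism on `P(Y)`. -/
noncomputable def evalPY {Y : Set (ℂ × ℂ)} (y : Y) : PY Y →+* ℂ where
  toFun f := (f : Y →ᵇ ℂ) y
  map_one' := rfl
  map_mul' _ _ := rfl
  map_zero' := rfl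
  map_add' _ _ := rfl

theorem continuous_evalPY {Y : Set (ℂ × ℂ)} (y : Y) : Continuous (evalPY y) :=
  (continuous_eval_const y).comp continuous_subtype_val

instance (Y : Set (ℂ × ℂ)) : CompleteSpace (PY Y) :=
  (polySub Y).isClosed_topologicalClosure.completeSpace_coe

theorem exists_PY_mul_eq_tower_succ {Y : Set (ℂ × ℂ)} {P : ℕ → MvPolynomial (Fin 2) ℂ}
    {M : ℕ → ℝ} {n : ℕ} {f : PY Y} (hf : ∀ y : Y, evalPY y f = tower P M n y) :
    ∃ u : PY Y, ∀ g : PY Y, (∀ y : Y, (g : Y →ᵇ ℂ) y = pev (P n) y) →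
      ∀ y : Y, evalPY y (u * g) = tower P M (n + 1) y := by
  let : NormedAlgebra ℚ (PY Y) := NormedAlgebra.restrictScalars ℚ ℂ (PY Y)
  refine ⟨(pev (P n) (0, 0))⁻¹ • NormedSpace.exp ((M n : ℂ) • (f - 1)), fun g hg y => ?_⟩
  have hsmul : ∀ (a : ℂ) (k : PY Y), evalPY y (a • k) = a * evalPY y k := fun a k => rfl
  have hg' : evalPY y g = pev (P n) y := hg y
  rw [map_mul, hsmul, NormedSpace.map_exp (evalPY y) (continuous_evalPY y), hsmul, map_sub,
    map_one, hf, hg', ← Complex.exp_eq_exp_ℂ, tower]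
  ring

theorem exists_PY_eq_tower {Y : Set (ℂ × ℂ)} (hY : IsCompact Y)
    (P : ℕ → MvPolynomial (Fin 2) ℂ) (M : ℕ → ℝ) (n : ℕ) :
    ∃ f : PY Y, ∀ y : Y, evalPY y f = tower P M n y := by
  induction n with
  | zero => exact ⟨1, fun y => rfl⟩
  | succ n ih =>
    obtain ⟨f, hf⟩ := ih
    obtain ⟨g, hg⟩ := exists_PY_eq_pev hY (P n)
    obtain ⟨u, hu⟩ := exists_PY_mul_eq_tower_succ hf
    exact ⟨u * g, hu g hg⟩

/-- An element of `P(Y)` whose real part is bounded below by a positive constant is invertible. -/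
theorem isUnit_of_half_le_re {Y : Set (ℂ × ℂ)} (f : PY Y)
    (h : ∀ y : Y, 1 / 2 ≤ (evalPY y f).re) : IsUnit f := by
  set R : ℝ := ‖f‖ ^ 2 + 1 with hR
  have hR0 : 1 ≤ R := by nlinarith [sq_nonneg ‖f‖]
  set s : ℝ := 1 / (2 * R) with hs
  have hs0 : 0 < s := by positivity
  have hsR : s * R = 1 / 2 := by rw [hs]; field_simp
  have hnorm : ‖(1 : PY Y) - (s : ℂ) • f‖ < 1 := by
    have hs1 : s ≤ 1 / 2 := by nlinarith
    have h2 : ‖(1 : PY Y) - (s : ℂ) • f‖ ≤ Real.sqrt (1 - s / 2) := by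
      refine (BoundedContinuousFunction.norm_le (Real.sqrt_nonneg _)).2 fun y => ?_
      refine Real.le_sqrt_of_sq_le ?_
      have h3 : (((1 : PY Y) - (s : ℂ) • f : PY Y) : Y →ᵇ ℂ) y = 1 + -(s * evalPY y f) := by
        rw [← sub_eq_add_neg]; rfl
      have h4 : ‖evalPY y f‖ ≤ ‖f‖ := (f : Y →ᵇ ℂ).norm_coe_le_norm y
      have h5 : ‖evalPY y f‖ ^ 2 ≤ R := by nlinarith [norm_nonneg (evalPY y f)]
      change ‖(((1 : PY Y) - (s : ℂ) • f : PY Y) : Y →ᵇ ℂ) y‖ ^ 2 ≤ _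
      rw [h3, norm_add_sq_complex]
      simp only [norm_one, map_one, one_mul, Complex.neg_re, Complex.re_ofReal_mul, norm_neg,
        norm_mul, Complex.norm_real, Real.norm_eq_abs, mul_pow, sq_abs]
      have := h y
      have h6 : s ^ 2 * ‖evalPY y f‖ ^ 2 ≤ s / 2 := by
        calc s ^ 2 * ‖evalPY y f‖ ^ 2 ≤ s ^ 2 * R := by gcongr
          _ = s / 2 := by rw [pow_two, mul_assoc, hsR]; ring
      nlinarith
    refine h2.trans_lt ((Real.sqrt_lt' one_pos).2 ?_)
    linarith
  have hu : IsUnit ((s : ℂ) • f) := by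
    have := isUnit_one_sub_of_norm_lt_one hnorm
    rwa [sub_sub_cancel] at this
  rw [Algebra.smul_def] at hu
  exact isUnit_of_mul_isUnit_right hu

theorem isUnit_PY_of_tower {Y : Set (ℂ × ℂ)} (hY : IsCompact Y)
    {P : ℕ → MvPolynomial (Fin 2) ℂ} {M : ℕ → ℝ} {n : ℕ}
    (h : ∀ y ∈ Y, 1 / 2 ≤ (tower P M (n + 1) y).re) {g : PY Y}
    (hg : ∀ y : Y, (g : Y →ᵇ ℂ) y = pev (P n) y) : IsUnit g := by
  obtain ⟨f, hf⟩ := exists_PY_eq_tower hY P M n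
  obtain ⟨u, hu⟩ := exists_PY_mul_eq_tower_succ hf
  exact isUnit_of_mul_isUnit_right (x := u)
    (isUnit_of_half_le_re _ fun y => by rw [hu g hg y]; exact h y y.2)

/-- Polynomials not vanishing at the origin admit a countable family dense for uniform convergence
on the bidisk. -/
theorem exists_dense_seq_polynomial : ∃ P : ℕ → MvPolynomial (Fin 2) ℂ,
    (∀ n, pev (P n) (0, 0) ≠ 0) ∧
    ∀ (Q : MvPolynomial (Fin 2) ℂ), pev Q (0, 0) ≠ 0 → ∀ ε : ℝ, 0 < ε →
      ∃ n, ∀ z ∈ bidisk, ‖pev Q z - pev (P n) z‖ < ε := by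
  have : CompactSpace bidisk := isCompact_iff_compactSpace.1 isCompact_bidisk
  let res : MvPolynomial (Fin 2) ℂ → C(bidisk, ℂ) := fun Q =>
    ⟨fun z => pev Q z, (continuous_pev Q).comp continuous_subtype_val⟩
  let T : Set C(bidisk, ℂ) := res '' {Q | pev Q (0, 0) ≠ 0}
  have : Nonempty T := ⟨⟨res 1, 1, by simp [pev], rfl⟩⟩
  choose P hP hPres using fun n => (TopologicalSpace.denseSeq T n).2
  refine ⟨P, hP, fun Q hQ ε hε => ?_⟩
  obtain ⟨n, hn⟩ := (TopologicalSpace.denseRange_denseSeq T).exists_dist_lt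
    (⟨res Q, Q, hQ, rfl⟩ : T) hε
  refine ⟨n, fun z hz => ?_⟩
  rw [Subtype.dist_eq, ← hPres n] at hn
  rw [← dist_eq_norm]
  exact (ContinuousMap.dist_apply_le_dist (f := res Q) (g := res (P n)) ⟨z, hz⟩).trans_lt hn

theorem dense_isUnit_PY {Y : Set (ℂ × ℂ)} (hY : IsCompact Y) (hYD : Y ⊆ bidisk)
    {P : ℕ → MvPolynomial (Fin 2) ℂ}
    (hdense : ∀ (Q : MvPolynomial (Fin 2) ℂ), pev Q (0, 0) ≠ 0 → ∀ ε : ℝ, 0 < ε →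
      ∃ n, ∀ z ∈ bidisk, ‖pev Q z - pev (P n) z‖ < ε)
    (hunit : ∀ n, ∀ g : PY Y, (∀ y : Y, (g : Y →ᵇ ℂ) y = pev (P n) y) → IsUnit g) :
    Dense {f : PY Y | IsUnit f} := by
  refine Metric.dense_iff.2 fun f r hr => ?_
  obtain ⟨k, ⟨Q, hQ⟩, hk⟩ := Metric.mem_closure_iff.1
    (show (f : Y →ᵇ ℂ) ∈ closure (polySub Y : Set (Y →ᵇ ℂ)) from f.2) (r / 4) (by positivity)
  obtain ⟨Q', hQ'0, hQ'⟩ : ∃ Q' : MvPolynomial (Fin 2) ℂ, pev Q' (0, 0) ≠ 0 ∧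
      ∀ z, ‖pev Q z - pev Q' z‖ ≤ r / 4 := by
    by_cases h0 : pev Q (0, 0) = 0
    · refine ⟨Q + MvPolynomial.C ((r / 4 : ℝ) : ℂ), ?_, fun z => ?_⟩
      · have : pev (Q + MvPolynomial.C ((r / 4 : ℝ) : ℂ)) (0, 0) = pev Q (0, 0) + (r / 4 : ℝ) := by
          simp [pev]
        rw [this, h0, zero_add, Ne, Complex.ofReal_eq_zero]
        positivity
      · have : pev (Q + MvPolynomial.C ((r / 4 : ℝ) : ℂ)) z = pev Q z + (r / 4 : ℝ) := by
          simp [pev]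
        rw [this, sub_add_cancel_left, norm_neg, Complex.norm_real, Real.norm_eq_abs,
          abs_of_pos (by positivity)]
    · exact ⟨Q, h0, fun z => by simp only [sub_self, norm_zero]; positivity⟩
  obtain ⟨n, hn⟩ := hdense Q' hQ'0 (r / 4) (by positivity)
  obtain ⟨g, hg⟩ := exists_PY_eq_pev hY (P n)
  refine ⟨g, ?_, hunit n g hg⟩
  rw [Metric.mem_ball, dist_comm, Subtype.dist_eq]
  have hkg : dist k (g : Y →ᵇ ℂ) ≤ r / 2 := by
    refine (BoundedContinuousFunction.dist_le (by positivity)).2 fun y => ?_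
    rw [hQ y, hg y]
    refine (dist_triangle _ (pev Q' y) _).trans ?_
    rw [dist_eq_norm, dist_eq_norm]
    linarith [hQ' y, hn y (hYD y.2)]
  linarith [dist_triangle (f : Y →ᵇ ℂ) k g]

/-- There exists a nonempty compact `Y ⊆ ∂𝔻̄²` with `(0,0) ∈ Ŷ` and `P(Y)` having dense
invertibles, such that, setting `X = Ŷ`, the set `Y` is exactly the Shilov boundary of
the polynomials on `X`: every polynomial attains its sup over `X` on `Y`, and `Y` is
contained in every closed subset of `X` with this property.  In particular this Shilov
boundary is proper, since `(0,0) ∈ X \ Y`. -/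
theorem stmt11 :
    ∃ Y : Set (ℂ × ℂ), Y.Nonempty ∧ IsCompact Y ∧ Y ⊆ frontier bidisk ∧
      ((0 : ℂ), (0 : ℂ)) ∈ polyHull Y ∧
      Dense {f : PY Y | IsUnit f} ∧
      (∀ q : MvPolynomial (Fin 2) ℂ,
        sSup ((fun z => ‖pev q z‖) '' Y) = sSup ((fun z => ‖pev q z‖) '' polyHull Y)) ∧
      (∀ S : Set (ℂ × ℂ), S ⊆ polyHull Y → IsClosed S →
        (∀ q : MvPolynomial (Fin 2) ℂ,
          sSup ((fun z => ‖pev q z‖) '' S) = sSup ((fun z => ‖pev q z‖) '' polyHull Y)) →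
        Y ⊆ S) ∧
      ((0 : ℂ), (0 : ℂ)) ∉ Y := by
  obtain ⟨P, hP0, hPdense⟩ := exists_dense_seq_polynomial
  choose M hM0 hM using fun n => exists_tower_exponent (P n)
  set Z := towerSet P M with hZ
  have hZf : Z ⊆ frontier bidisk := fun y hy => hy.1
  have hZc : IsCompact Z := isCompact_towerSet P M
  have h0Z : ((0 : ℂ), (0 : ℂ)) ∈ polyHull Z := zero_mem_polyHull_towerSet hP0 hM0 hM
  have hZne : Z.Nonempty := by
    by_contra! h
    have := h0Z 1 0 (by simp [h])
    simp [pev] at this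
    linarith
  have hXc : IsCompact (polyHull Z) := isCompact_polyHull (hZf.trans frontier_bidisk_subset)
  have hbd := isPolyBoundary_shilovBoundary hXc ⟨_, h0Z⟩
  set Y := shilovBoundary (polyHull Z) with hY
  have hYZ : Y ⊆ Z := fun y hy => hy.2 Z (isPolyBoundary_polyHull hZc hZne)
  have hYc : IsCompact Y := hZc.of_isClosed_subset hbd.isClosed hYZ
  have hhull : polyHull Y = polyHull Z := hbd.polyHull_eq hYZ
  have hYD : Y ⊆ bidisk := hYZ.trans (hZf.trans frontier_bidisk_subset)
  refine ⟨Y, ?_, hYc, hYZ.trans hZf, hhull ▸ h0Z, ?_, ?_, ?_, ?_⟩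
  · obtain ⟨s, hs, -⟩ := hbd.exists_max 1
    exact ⟨s, hs⟩
  · refine dense_isUnit_PY hYc hYD hPdense fun n g hg => ?_
    exact isUnit_PY_of_tower hYc
      (fun y hy => half_le_re_tower hM0 hM (hYD hy) ((hYZ hy).2 (n + 2))) hg
  · rw [hhull]
    exact hbd.sSup_eq
  · rw [hhull]
    exact fun S hSX hS h y hy => hy.2 S (isPolyBoundary_of_sSup_eq hXc ⟨_, h0Z⟩ hSX hS h)
  · exact fun h => (hZf (hYZ h)).2 zero_mem_interior_bidisk
end
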